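/- For every integer n ≥ 2, the Möbius function of the poset NC^B(n-1,1) satisfies μ(0̂, 1̂) = (-1)^n · C(2n-1, n) · (5n-4)/(4n-2). -/

import Mathlib

/-!  Common setup: annular non-crossing partitions of type B, following
Goulden–Nica–Oancea, "Enumerative properties of NC^(B)(p,q)". -/

/-- The underlying set `{±1, …, ±n}`, realized inside `ℤ`. -/
def signedSet (n : ℕ) : Set ℤ := {x : ℤ | x ≠ 0 ∧ |x| ≤ (n : ℤ)}

/-- Membership in the hyperoctahedral group `B_n`, realized as the permutations of `ℤ`
that commute with negation and fix every point outside `{±1, …, ±n}`. -/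
def inB (n : ℕ) (π : Equiv.Perm ℤ) : Prop :=
  (∀ x : ℤ, π (-x) = -(π x)) ∧ ∀ x : ℤ, x ∉ signedSet n → π x = x

/-- The set of generators of `B_n`:
`(i,j)(-i,-j)`, `(i,-j)(-i,j)` for `1 ≤ i ≠ j ≤ n`, and `(i,-i)` for `1 ≤ i ≤ n`. -/
def genB (n : ℕ) : Set (Equiv.Perm ℤ) :=
  {π | (∃ i j : ℤ, 1 ≤ i ∧ i ≤ (n : ℤ) ∧ 1 ≤ j ∧ j ≤ (n : ℤ) ∧ i ≠ j ∧
          π = Equiv.swap i j * Equiv.swap (-i) (-j)) ∨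
       (∃ i j : ℤ, 1 ≤ i ∧ i ≤ (n : ℤ) ∧ 1 ≤ j ∧ j ≤ (n : ℤ) ∧ i ≠ j ∧
          π = Equiv.swap i (-j) * Equiv.swap (-i) j) ∨
       (∃ i : ℤ, 1 ≤ i ∧ i ≤ (n : ℤ) ∧ π = Equiv.swap i (-i))}

/-- The length function `ℓ_B` on `B_n`: the least `k` such that `τ` is a product of `k`
generators from `genB n` (the empty product being the identity). -/
noncomputable def lenB (n : ℕ) (τ : Equiv.Perm ℤ) : ℕ :=
  sInf {k : ℕ | ∃ l : List (Equiv.Perm ℤ),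
    l.length = k ∧ (∀ g ∈ l, g ∈ genB n) ∧ l.prod = τ}

/-- The partial order on `B_n`:  `τ ≤ σ` iff `ℓ_B(σ) = ℓ_B(τ) + ℓ_B(τ⁻¹σ)`. -/
def leB (n : ℕ) (τ σ : Equiv.Perm ℤ) : Prop :=
  lenB n σ = lenB n τ + lenB n (τ⁻¹ * σ)

/-- The permutation `γ_{p,q} = (1,…,p,-1,…,-p)(p+1,…,p+q,-(p+1),…,-(p+q))`. -/
def gammaPQ (p q : ℕ) : Equiv.Perm ℤ :=
  (((List.range p).map fun i => ((i : ℤ) + 1)) ++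
      ((List.range p).map fun i => -((i : ℤ) + 1))).formPerm *
    (((List.range q).map fun i => ((p : ℤ) + (i : ℤ) + 1)) ++
      ((List.range q).map fun i => -((p : ℤ) + (i : ℤ) + 1))).formPerm

/-- The long cycle `γ_n = (1,…,n,-1,…,-n)` of `B_n` (disc case). -/
def gammaDisc (n : ℕ) : Equiv.Perm ℤ :=
  (((List.range n).map fun i => ((i : ℤ) + 1)) ++
    ((List.range n).map fun i => -((i : ℤ) + 1))).formPerm

/-- The annular non-crossing permutations of type B: `S^B_nc(p,q) = [ε, γ_{p,q}] ⊆ B_{p+q}`. -/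
def SncB (p q : ℕ) : Set (Equiv.Perm ℤ) :=
  {τ | inB (p + q) τ ∧ leB (p + q) τ (gammaPQ p q)}

/-- The orbit of `x` under the permutation `τ`. -/
def permOrbit (τ : Equiv.Perm ℤ) (x : ℤ) : Set ℤ := {y | ∃ m : ℤ, (τ ^ m) x = y}

/-- The partition `Ω(τ)` of `{±1,…,±n}` into orbits of `τ`. -/
def orbitsOn (n : ℕ) (τ : Equiv.Perm ℤ) : Set (Set ℤ) :=
  {A | ∃ x ∈ signedSet n, A = permOrbit τ x}

/-- The negation `-A` of a set `A ⊆ ℤ`. -/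
def negSet (A : Set ℤ) : Set ℤ := {x | -x ∈ A}

/-- The partition `Ω̃(τ)`, obtained from `Ω(τ)` by merging all inversion-invariant orbits
(orbits `A` with `A = -A`) into a single block. -/
def omegaTilde (n : ℕ) (τ : Equiv.Perm ℤ) : Set (Set ℤ) :=
  {A | A ∈ orbitsOn n τ ∧ negSet A ≠ A} ∪
    {B | B = ⋃₀ {A | A ∈ orbitsOn n τ ∧ negSet A = A} ∧ B.Nonempty}

/-- The annular non-crossing partitions of type B: `NC^B(p,q) = {Ω̃(τ) : τ ∈ S^B_nc(p,q)}`. -/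
def NCB (p q : ℕ) : Set (Set (Set ℤ)) :=
  {π | ∃ τ ∈ SncB p q, π = omegaTilde (p + q) τ}

/-- The type B non-crossing partitions of the disc: `NC^B(n) = {Ω̃(τ) : τ ∈ B_n, τ ≤ γ_n}`. -/
def NCBdisc (n : ℕ) : Set (Set (Set ℤ)) :=
  {π | ∃ τ, inB n τ ∧ leB n τ (gammaDisc n) ∧ π = omegaTilde n τ}

/-- Reverse refinement order on partitions: every block of `π` is contained in a block of `ρ`. -/
def refines (π ρ : Set (Set ℤ)) : Prop := ∀ A ∈ π, ∃ B ∈ ρ, A ⊆ B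

/-- The rank of a partition of `{±1,…,±n}`:
`n` minus half the number of blocks `A` with `A ≠ -A`. -/
noncomputable def rankNCB (n : ℕ) (π : Set (Set ℤ)) : ℕ :=
  n - {A | A ∈ π ∧ negSet A ≠ A}.ncard / 2

/-- The inner point set `{±(p+1), …, ±(p+q)}`. -/
def innerSet (p q : ℕ) : Set ℤ := {x : ℤ | (p : ℤ) < |x| ∧ |x| ≤ (p : ℤ) + (q : ℤ)}

/-- The connectivity of `π ∈ NC^B(p,q)`: half the number of blocks `A` with `A ≠ -A`
meeting both `{±1,…,±p}` and `{±(p+1),…,±(p+q)}`. -/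
noncomputable def connectivity (p q : ℕ) (π : Set (Set ℤ)) : ℕ :=
  {A | A ∈ π ∧ negSet A ≠ A ∧ (A ∩ signedSet p).Nonempty ∧
    (A ∩ innerSet p q).Nonempty}.ncard / 2

/-- The number of exterior pairs of blocks `{A, -A}` (with `A ≠ -A`, `A ⊆ {±1,…,±p}`). -/
noncomputable def extPairs (p : ℕ) (π : Set (Set ℤ)) : ℕ :=
  {A | A ∈ π ∧ negSet A ≠ A ∧ A ⊆ signedSet p}.ncard / 2

/-- The number of interior pairs of blocks `{A, -A}`
(with `A ≠ -A`, `A ⊆ {±(p+1),…,±(p+q)}`). -/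
noncomputable def intPairs (p q : ℕ) (π : Set (Set ℤ)) : ℕ :=
  {A | A ∈ π ∧ negSet A ≠ A ∧ A ⊆ innerSet p q}.ncard / 2

/-- The minimum `0̂` of `NC^B(p,q)` (with `n = p+q`): the partition into singletons. -/
def botNCB (n : ℕ) : Set (Set ℤ) := {A | ∃ x ∈ signedSet n, A = {x}}

/-- The maximum `1̂` of `NC^B(p,q)` (with `n = p+q`): the partition with a single block. -/
def topNCB (n : ℕ) : Set (Set ℤ) := {signedSet n}

/-- The orbit of `x` under the subgroup generated by `{τ, γ}`. -/
def jointOrbit (τ γ : Equiv.Perm ℤ) (x : ℤ) : Set ℤ :=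
  {y | ∃ g ∈ Subgroup.closure ({τ, γ} : Set (Equiv.Perm ℤ)), g x = y}

/-- The orbits on `{±1,…,±n}` of the subgroup generated by `{τ, γ}`. -/
def jointOrbitsOn (n : ℕ) (τ γ : Equiv.Perm ℤ) : Set (Set ℤ) :=
  {Y | ∃ x ∈ signedSet n, Y = jointOrbit τ γ x}

namespace NB
open Matrix
variable {n : ℕ}

def e (n : ℕ) (i : ℤ) : Fin n → ℚ :=
  fun k => if i = (k : ℤ) + 1 then 1 else if i = -((k : ℤ) + 1) then -1 else 0

lemma e_neg (i : ℤ) : e n (-i) = - e n i := by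
  funext k
  simp only [e, Pi.neg_apply]
  split_ifs <;> first | omega | simp

lemma ai (w : Equiv.Perm ℤ) (i : ℤ) : w (w⁻¹ i) = i := w.apply_symm_apply i
lemma ia (w : Equiv.Perm ℤ) (i : ℤ) : w⁻¹ (w i) = i := w.symm_apply_apply i

lemma mem_S {i : ℤ} : i ∈ signedSet n ↔ i ≠ 0 ∧ -(n:ℤ) ≤ i ∧ i ≤ n := by
  simp only [signedSet, Set.mem_ofPred_eq, abs_le]

lemma neg_S {i : ℤ} : -i ∈ signedSet n ↔ i ∈ signedSet n := by
  simp only [mem_S]; omega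

lemma S_cases {i : ℤ} (h : i ∈ signedSet n) : ∃ k : Fin n, i = (k:ℤ)+1 ∨ i = -((k:ℤ)+1) := by
  rw [mem_S] at h
  rcases lt_or_gt_of_ne h.1 with h0 | h0
  · refine ⟨⟨(-i-1).toNat, by omega⟩, Or.inr ?_⟩
    simp only; omega
  · refine ⟨⟨(i-1).toNat, by omega⟩, Or.inl ?_⟩
    simp only; omega

lemma pos_S (k : Fin n) : ((k:ℤ)+1) ∈ signedSet n := by
  rw [mem_S]; have := k.2; omega

lemma e_out {i : ℤ} (h : i ∉ signedSet n) : e n i = 0 := by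
  funext k
  have := k.2
  rw [mem_S] at h
  simp only [e, Pi.zero_apply]
  split_ifs <;> first | omega | rfl

lemma e_pos (k : Fin n) : e n ((k:ℤ)+1) = Pi.single k 1 := by
  funext j
  simp only [e, Pi.single_apply, Fin.ext_iff]
  split_ifs <;> first | omega | rfl

lemma dot_pos (v : Fin n → ℚ) (k : Fin n) : v ⬝ᵥ e n ((k:ℤ)+1) = v k := by
  rw [e_pos]; simp

lemma dot_self {i : ℤ} (h : i ∈ signedSet n) : e n i ⬝ᵥ e n i = 1 := by
  obtain ⟨k, rfl | rfl⟩ := S_cases h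
  · rw [dot_pos, e_pos]; simp
  · rw [e_neg, neg_dotProduct, dotProduct_neg, neg_neg, dot_pos, e_pos]; simp

lemma dot_ne {i j : ℤ} (h1 : i ≠ j) (h2 : i ≠ -j) : e n i ⬝ᵥ e n j = 0 := by
  by_cases hj : j ∈ signedSet n
  · obtain ⟨k, rfl | rfl⟩ := S_cases hj
    · rw [dot_pos]; simp only [e]; rw [if_neg h1, if_neg h2]
    · rw [e_neg, dotProduct_neg, dot_pos]
      rw [neg_neg] at h2
      simp only [e]; rw [if_neg h2, if_neg h1, neg_zero]
  · rw [e_out hj]; simp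

lemma v_ext {v u : Fin n → ℚ} (h : ∀ i ∈ signedSet n, v ⬝ᵥ e n i = u ⬝ᵥ e n i) : v = u := by
  funext k
  rw [← dot_pos v, ← dot_pos u]
  exact h _ (pos_S k)

def rho (n : ℕ) (w : Equiv.Perm ℤ) : (Fin n → ℚ) →ₗ[ℚ] (Fin n → ℚ) :=
  Fintype.linearCombination ℚ (fun k : Fin n => e n (w ((k:ℤ)+1)))

lemma rho_apply (w : Equiv.Perm ℤ) (v : Fin n → ℚ) :
    rho n w v = ∑ k, v k • e n (w ((k:ℤ)+1)) := rfl

lemma inB_mem {w : Equiv.Perm ℤ} (hw : inB n w) {i : ℤ} :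
    w i ∈ signedSet n ↔ i ∈ signedSet n := by
  constructor
  · intro h
    by_contra hi
    rw [hw.2 i hi] at h
    exact hi h
  · intro h
    by_contra hi
    have := hw.2 _ hi
    rw [EmbeddingLike.apply_eq_iff_eq] at this
    rw [this] at hi
    exact hi h

lemma inB_one : inB n 1 := ⟨fun _ => rfl, fun _ _ => rfl⟩

lemma inB_mul {x y : Equiv.Perm ℤ} (hx : inB n x) (hy : inB n y) : inB n (x * y) := by
  refine ⟨fun i => ?_, fun i hi => ?_⟩
  · simp [hx.1, hy.1]
  · simp [hx.2 _ hi, hy.2 _ hi]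

lemma inB_inv {x : Equiv.Perm ℤ} (hx : inB n x) : inB n x⁻¹ := by
  refine ⟨fun i => ?_, fun i hi => ?_⟩
  · rw [Equiv.Perm.inv_eq_iff_eq, hx.1]; simp
  · rw [Equiv.Perm.inv_eq_iff_eq, hx.2 _ hi]

lemma rho_e {w : Equiv.Perm ℤ} (hw : inB n w) (i : ℤ) : rho n w (e n i) = e n (w i) := by
  have key : ∀ k : Fin n, rho n w (e n ((k:ℤ)+1)) = e n (w ((k:ℤ)+1)) := by
    intro k
    rw [rho_apply, e_pos, Finset.sum_eq_single k]
    · simp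
    · intro b _ hb; simp [hb]
    · simp
  by_cases h : i ∈ signedSet n
  · obtain ⟨k, rfl | rfl⟩ := S_cases h
    · exact key k
    · rw [e_neg, map_neg, key, hw.1, e_neg]
  · rw [hw.2 i h, e_out h, map_zero]

lemma lin_ext {f g : (Fin n → ℚ) →ₗ[ℚ] (Fin n → ℚ)} (h : ∀ i, f (e n i) = g (e n i)) : f = g := by
  apply LinearMap.pi_ext'
  intro k
  ext1
  have := h ((k:ℤ)+1)
  rw [e_pos] at this
  simpa using this

lemma rho_mul {x y : Equiv.Perm ℤ} (hx : inB n x) (hy : inB n y) (v : Fin n → ℚ) :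
    rho n (x * y) v = rho n x (rho n y v) := by
  have : rho n (x * y) = (rho n x).comp (rho n y) := by
    apply lin_ext
    intro i
    rw [LinearMap.comp_apply, rho_e (inB_mul hx hy), rho_e hy, rho_e hx]; rfl
  rw [this]; rfl

lemma rho_one (v : Fin n → ℚ) : rho n 1 v = v := by
  have : rho n 1 = LinearMap.id := by
    apply lin_ext
    intro i
    rw [rho_e inB_one]; rfl
  rw [this]; rfl

lemma ee_dot {w : Equiv.Perm ℤ} (hw : inB n w) (i j : ℤ) :
    e n (w i) ⬝ᵥ e n (w j) = e n i ⬝ᵥ e n j := by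
  by_cases hi : i ∈ signedSet n
  · by_cases h1 : i = j
    · subst h1; rw [dot_self hi, dot_self ((inB_mem hw).2 hi)]
    · by_cases h2 : i = -j
      · subst h2
        rw [neg_S] at hi
        rw [hw.1, e_neg, e_neg, neg_dotProduct, neg_dotProduct, dot_self hi,
          dot_self ((inB_mem hw).2 hi)]
      · rw [dot_ne h1 h2, dot_ne]
        · simpa using h1
        · rw [← hw.1]; simpa using h2
  · rw [hw.2 i hi, e_out hi]; simp

lemma rho_dot_e {w : Equiv.Perm ℤ} (hw : inB n w) (v : Fin n → ℚ) (i : ℤ) :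
    rho n w v ⬝ᵥ e n (w i) = v ⬝ᵥ e n i := by
  rw [rho_apply, sum_dotProduct]
  simp only [smul_dotProduct, ee_dot hw]
  have : v = ∑ k, v k • e n ((k:ℤ)+1) := by
    simp only [e_pos]
    funext j
    simp [Finset.sum_apply, Pi.single_apply]
  conv_rhs => rw [this, sum_dotProduct]
  simp only [smul_dotProduct]

/-- moved space -/
def Mv (n : ℕ) (w : Equiv.Perm ℤ) : Submodule ℚ (Fin n → ℚ) :=
  Submodule.span ℚ (Set.range fun i : ℤ => e n (w i) - e n i)

lemma mem_Mv (w : Equiv.Perm ℤ) (i : ℤ) : e n (w i) - e n i ∈ Mv n w :=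
  Submodule.subset_span ⟨i, rfl⟩

lemma mem_Mv' (w : Equiv.Perm ℤ) (i : ℤ) : e n i - e n (w i) ∈ Mv n w := by
  rw [← neg_sub]; exact neg_mem (mem_Mv w i)

lemma Mv_le {w : Equiv.Perm ℤ} {U : Submodule ℚ (Fin n → ℚ)}
    (h : ∀ i ∈ signedSet n, e n (w i) - e n i ∈ U) (hw : inB n w) : Mv n w ≤ U := by
  rw [Mv, Submodule.span_le]
  rintro _ ⟨i, rfl⟩
  by_cases hi : i ∈ signedSet n
  · exact h i hi
  · simp [hw.2 i hi]

lemma Mv_eq_range {w : Equiv.Perm ℤ} (hw : inB n w) :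
    Mv n w = LinearMap.range (rho n w - LinearMap.id) := by
  apply le_antisymm
  · rw [Mv, Submodule.span_le]
    rintro _ ⟨i, rfl⟩
    exact ⟨e n i, by simp [rho_e hw]⟩
  · rintro _ ⟨v, rfl⟩
    have : v = ∑ k, v k • e n ((k:ℤ)+1) := by
      simp only [e_pos]
      funext j
      simp [Finset.sum_apply, Pi.single_apply]
    rw [this, map_sum]
    refine Submodule.sum_mem _ fun k _ => ?_
    rw [map_smul]
    refine Submodule.smul_mem _ _ ?_
    simp only [LinearMap.sub_apply, rho_e hw, LinearMap.id_apply]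
    exact mem_Mv _ _

def Fx (n : ℕ) (w : Equiv.Perm ℤ) : Submodule ℚ (Fin n → ℚ) :=
  LinearMap.ker (rho n w - LinearMap.id)

lemma mem_Fx {w : Equiv.Perm ℤ} {v : Fin n → ℚ} : v ∈ Fx n w ↔ rho n w v = v := by
  rw [Fx, LinearMap.mem_ker, LinearMap.sub_apply, sub_eq_zero]; rfl

noncomputable def rk (n : ℕ) (w : Equiv.Perm ℤ) : ℕ := Module.finrank ℚ (Mv n w)

lemma rk_add {w : Equiv.Perm ℤ} (hw : inB n w) : rk n w + Module.finrank ℚ (Fx n w) = n := by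
  have := LinearMap.finrank_range_add_finrank_ker (rho n w - LinearMap.id)
  rw [← Mv_eq_range hw] at this
  rw [Module.finrank_fin_fun] at this
  exact this

lemma mem_Fx_iff {w : Equiv.Perm ℤ} (hw : inB n w) {v : Fin n → ℚ} :
    v ∈ Fx n w ↔ ∀ m ∈ Mv n w, v ⬝ᵥ m = 0 := by
  rw [mem_Fx]
  constructor
  · intro h m hm
    induction hm using Submodule.span_induction with
    | mem x hx =>
      obtain ⟨i, rfl⟩ := hx
      have := rho_dot_e hw v i
      rw [h] at this
      simp [dotProduct_sub, this]
    | zero => simp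
    | add x y _ _ h1 h2 => simp [dotProduct_add, h1, h2]
    | smul a x _ h => simp [dotProduct_smul, h]
  · intro h
    apply v_ext
    intro i _
    have h1 := rho_dot_e hw v (w⁻¹ i)
    have h2 := h _ (mem_Mv w (w⁻¹ i))
    rw [show w (w⁻¹ i) = i from w.apply_symm_apply i] at h1 h2
    rw [dotProduct_sub] at h2
    linarith

lemma Fx_anti {x y : Equiv.Perm ℤ} (hx : inB n x) (hy : inB n y) (h : Mv n x ≤ Mv n y) :
    Fx n y ≤ Fx n x := by
  intro v hv
  rw [mem_Fx_iff hx]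
  rw [mem_Fx_iff hy] at hv
  exact fun m hm => hv m (h hm)

lemma Mv_mul (x y : Equiv.Perm ℤ) : Mv n (x * y) ≤ Mv n x ⊔ Mv n y := by
  rw [Mv, Submodule.span_le]
  rintro _ ⟨i, rfl⟩
  have : e n ((x * y) i) - e n i = (e n (x (y i)) - e n (y i)) + (e n (y i) - e n i) := by
    simp
  simp only [this]
  exact Submodule.add_mem_sup (mem_Mv _ _) (mem_Mv _ _)

lemma Mv_inv (x : Equiv.Perm ℤ) : Mv n x⁻¹ = Mv n x := by
  have key : ∀ x : Equiv.Perm ℤ, Mv n x⁻¹ ≤ Mv n x := by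
    intro x
    rw [Mv, Submodule.span_le]
    rintro _ ⟨i, rfl⟩
    have := mem_Mv' (n := n) x (x⁻¹ i)
    simpa using this
  apply le_antisymm (key x)
  simpa using key x⁻¹

lemma rk_inv (x : Equiv.Perm ℤ) : rk n x⁻¹ = rk n x := by rw [rk, Mv_inv]; rfl

lemma rk_mul (x y : Equiv.Perm ℤ) : rk n (x * y) ≤ rk n x + rk n y :=
  (Submodule.finrank_mono (Mv_mul x y)).trans (Submodule.finrank_add_le_finrank_add_finrank _ _)

lemma Mv_one : Mv n 1 = ⊥ := by
  rw [Mv, Submodule.span_eq_bot]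
  rintro _ ⟨i, rfl⟩; simp

lemma rk_one : rk n 1 = 0 := by rw [rk, Mv_one]; simp

lemma e_inj {i j : ℤ} (hi : i ∈ signedSet n) (h : e n i = e n j) : i = j := by
  by_contra hij
  have h1 := dot_self hi
  by_cases h2 : i = -j
  · rw [h2, e_neg] at h
    have : e n j ⬝ᵥ e n j = 0 := by
      have h3 : e n j ⬝ᵥ e n j = (- e n j) ⬝ᵥ e n j := by rw [h]
      rw [neg_dotProduct] at h3; linarith
    have hj : j ∈ signedSet n := by rw [h2, neg_S] at hi; exact hi
    rw [dot_self hj] at this; norm_num at this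
  · have := dot_ne (n := n) hij h2
    rw [← h, h1] at this; norm_num at this

lemma eq_one_of_Mv {w : Equiv.Perm ℤ} (hw : inB n w) (h : rk n w = 0) : w = 1 := by
  rw [rk, Submodule.finrank_eq_zero] at h
  ext i
  by_cases hi : i ∈ signedSet n
  · have := mem_Mv (n := n) w i
    rw [h, Submodule.mem_bot, sub_eq_zero] at this
    rw [e_inj ((inB_mem hw).2 hi) this]; rfl
  · rw [hw.2 i hi]; rfl

/-- reflections -/
def rf (i k : ℤ) : Equiv.Perm ℤ :=
  if k = -i then Equiv.swap i (-i) else Equiv.swap i k * Equiv.swap (-i) (-k)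

lemma rf_left {i k : ℤ} (hi : i ≠ 0) (hk : k ≠ 0) : rf i k i = k := by
  unfold rf; split_ifs with h
  · simp [h]
  · rw [Equiv.Perm.mul_apply, Equiv.swap_apply_of_ne_of_ne (a := -i) (b := -k) (by omega) (by omega),
      Equiv.swap_apply_left]

lemma rf_right {i k : ℤ} (hi : i ≠ 0) (hk : k ≠ 0) : rf i k k = i := by
  unfold rf; split_ifs with h
  · simp [h]
  · rw [Equiv.Perm.mul_apply, Equiv.swap_apply_of_ne_of_ne (a := -i) (b := -k) (by omega) (by omega),
      Equiv.swap_apply_right]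

lemma rf_of_ne {i k j : ℤ} (h1 : j ≠ i) (h2 : j ≠ -i) (h3 : j ≠ k) (h4 : j ≠ -k) :
    rf i k j = j := by
  unfold rf; split_ifs with h
  · exact Equiv.swap_apply_of_ne_of_ne h1 h2
  · rw [Equiv.Perm.mul_apply, Equiv.swap_apply_of_ne_of_ne h2 h4, Equiv.swap_apply_of_ne_of_ne h1 h3]

lemma rf_nleft {i k : ℤ} (_ : i ≠ 0) (hk : k ≠ 0) (hik : i ≠ k) : rf i k (-i) = -k := by
  unfold rf; split_ifs with h
  · simp [h]
  · rw [Equiv.Perm.mul_apply, Equiv.swap_apply_left (-i),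
      Equiv.swap_apply_of_ne_of_ne (by omega) (by omega)]

lemma rf_nright {i k : ℤ} (_ : i ≠ 0) (hk : k ≠ 0) (hik : i ≠ k) : rf i k (-k) = -i := by
  unfold rf; split_ifs with h
  · simp [h]
  · rw [Equiv.Perm.mul_apply, Equiv.swap_apply_right (-i),
      Equiv.swap_apply_of_ne_of_ne (by omega) (by omega)]

lemma S_ne {i : ℤ} (hi : i ∈ signedSet n) : i ≠ 0 := hi.1

lemma rf_inB {i k : ℤ} (hi : i ∈ signedSet n) (hk : k ∈ signedSet n) (hik : i ≠ k) :
    inB n (rf i k) := by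
  have hi0 := S_ne hi
  have hk0 := S_ne hk
  refine ⟨fun j => ?_, fun j hj => ?_⟩
  · by_cases h1 : j = i
    · subst h1; rw [rf_nleft hi0 hk0 hik, rf_left hi0 hk0]
    by_cases h2 : j = -i
    · subst h2; rw [neg_neg, rf_nleft hi0 hk0 hik, rf_left hi0 hk0, neg_neg]
    by_cases h3 : j = k
    · subst h3; rw [rf_nright hi0 hk0 hik, rf_right hi0 hk0]
    by_cases h4 : j = -k
    · subst h4; rw [neg_neg, rf_nright hi0 hk0 hik, rf_right hi0 hk0, neg_neg]
    rw [rf_of_ne h1 h2 h3 h4, rf_of_ne] <;> omega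
  · apply rf_of_ne <;> rintro rfl <;> first | exact hj hi | exact hj hk | exact hj (neg_S.2 hi) | exact hj (neg_S.2 hk)

lemma rf_rf {i k : ℤ} (hi0 : i ≠ 0) (hk0 : k ≠ 0) (hik : i ≠ k) : rf i k * rf i k = 1 := by
  ext j
  rw [Equiv.Perm.mul_apply, Equiv.Perm.one_apply]
  by_cases h1 : j = i
  · subst h1; rw [rf_left hi0 hk0, rf_right hi0 hk0]
  by_cases h2 : j = -i
  · subst h2; rw [rf_nleft hi0 hk0 hik, rf_nright hi0 hk0 hik]
  by_cases h3 : j = k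
  · subst h3; rw [rf_right hi0 hk0, rf_left hi0 hk0]
  by_cases h4 : j = -k
  · subst h4; rw [rf_nright hi0 hk0 hik, rf_nleft hi0 hk0 hik]
  rw [rf_of_ne h1 h2 h3 h4, rf_of_ne h1 h2 h3 h4]

lemma rf_comm {i k : ℤ} (hi0 : i ≠ 0) (hk0 : k ≠ 0) (hik : i ≠ k) : rf i k = rf k i := by
  ext j
  by_cases h1 : j = i
  · subst h1; rw [rf_left hi0 hk0, rf_right hk0 hi0]
  by_cases h2 : j = -i
  · subst h2; rw [rf_nleft hi0 hk0 hik, rf_nright hk0 hi0 hik.symm]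
  by_cases h3 : j = k
  · subst h3; rw [rf_right hi0 hk0, rf_left hk0 hi0]
  by_cases h4 : j = -k
  · subst h4; rw [rf_nright hi0 hk0 hik, rf_nleft hk0 hi0 hik.symm]
  rw [rf_of_ne h1 h2 h3 h4, rf_of_ne h3 h4 h1 h2]

lemma rf_inv {i k : ℤ} (hi0 : i ≠ 0) (hk0 : k ≠ 0) (hik : i ≠ k) : (rf i k)⁻¹ = rf i k :=
  inv_eq_of_mul_eq_one_left (rf_rf hi0 hk0 hik)

lemma Mv_rf {i k : ℤ} (hi : i ∈ signedSet n) (hk : k ∈ signedSet n) (hik : i ≠ k) :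
    Mv n (rf i k) ≤ Submodule.span ℚ {e n i - e n k} := by
  have hi0 := S_ne hi
  have hk0 := S_ne hk
  apply Mv_le _ (rf_inB hi hk hik)
  have hα : e n i - e n k ∈ Submodule.span ℚ {e n i - e n k} := Submodule.mem_span_singleton_self _
  intro j _
  by_cases h1 : j = i
  · subst h1; rw [rf_left hi0 hk0]; convert neg_mem hα using 1; abel
  by_cases h2 : j = -i
  · subst h2; rw [rf_nleft hi0 hk0 hik, e_neg, e_neg]; convert hα using 1; abel
  by_cases h3 : j = k
  · subst h3; rw [rf_right hi0 hk0]; exact hα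
  by_cases h4 : j = -k
  · subst h4; rw [rf_nright hi0 hk0 hik, e_neg, e_neg]; convert neg_mem hα using 1; abel
  rw [rf_of_ne h1 h2 h3 h4]; simp

lemma rk_rf {i k : ℤ} (hi : i ∈ signedSet n) (hk : k ∈ signedSet n) (hik : i ≠ k) :
    rk n (rf i k) ≤ 1 :=
  (Submodule.finrank_mono (Mv_rf hi hk hik)).trans (by
    have := finrank_span_le_card (R := ℚ) ({e n i - e n k} : Set (Fin n → ℚ))
    simpa only [Set.toFinset_singleton, Finset.card_singleton] using this)

lemma rf_gen {i k : ℤ} (hi : i ∈ signedSet n) (hk : k ∈ signedSet n) (hik : i ≠ k) :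
    rf i k ∈ genB n := by
  rw [mem_S] at hi hk
  simp only [genB, Set.mem_ofPred_eq]
  by_cases h : k = -i
  · right; right
    rcases lt_or_gt_of_ne hi.1 with h0 | h0
    · refine ⟨-i, by omega, by omega, ?_⟩
      rw [rf, if_pos h, neg_neg, Equiv.swap_comm]
    · refine ⟨i, by omega, by omega, ?_⟩
      rw [rf, if_pos h]
  · rw [rf, if_neg h]
    rcases lt_or_gt_of_ne hi.1 with h0 | h0 <;> rcases lt_or_gt_of_ne hk.1 with h1 | h1
    · left
      refine ⟨-i, -k, by omega, by omega, by omega, by omega, by omega, ?_⟩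
      rw [neg_neg, neg_neg]
      exact (Equiv.Perm.disjoint_swap_swap (by simp; omega)).commute.eq
    · right; left
      refine ⟨-i, k, by omega, by omega, by omega, by omega, by omega, ?_⟩
      rw [neg_neg]
      exact (Equiv.Perm.disjoint_swap_swap (by simp; omega)).commute.eq
    · right; left
      refine ⟨i, -k, by omega, by omega, by omega, by omega, by omega, ?_⟩
      rw [neg_neg]
    · left
      exact ⟨i, k, by omega, by omega, by omega, by omega, by omega, rfl⟩

lemma gen_rf {g : Equiv.Perm ℤ} (hg : g ∈ genB n) :
    ∃ i k : ℤ, i ∈ signedSet n ∧ k ∈ signedSet n ∧ i ≠ k ∧ g = rf i k := by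
  simp only [mem_S]
  rcases hg with ⟨i, j, h1, h2, h3, h4, h5, rfl⟩ | ⟨i, j, h1, h2, h3, h4, h5, rfl⟩ | ⟨i, h1, h2, rfl⟩
  · exact ⟨i, j, by omega, by omega, h5, by rw [rf, if_neg (by omega)]⟩
  · exact ⟨i, -j, by omega, by omega, by omega, by rw [rf, if_neg (by omega), neg_neg]⟩
  · exact ⟨i, -i, by omega, by omega, by omega, by rw [rf, if_pos rfl]⟩

end NB

namespace NB
open Matrix
variable {n : ℕ}

lemma rk_conj_left {u : Equiv.Perm ℤ} {i k : ℤ} (hi : i ∈ signedSet n) (hk : k ∈ signedSet n) (hik : i ≠ k) :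
    rk n u ≤ rk n (rf i k * u) + 1 := by
  have h := rk_mul (n := n) (rf i k) (rf i k * u)
  rw [← mul_assoc, rf_rf (S_ne hi) (S_ne hk) hik, one_mul] at h
  have := rk_rf hi hk hik
  omega

lemma carter_left {u : Equiv.Perm ℤ} (hu : inB n u) {i k : ℤ} (hi : i ∈ signedSet n)
    (hk : k ∈ signedSet n) (hik : i ≠ k) (h : e n i - e n k ∈ Mv n u) :
    rk n (rf i k * u) + 1 = rk n u := by
  have hi0 := S_ne hi
  have hk0 := S_ne hk
  have ht := rf_inB hi hk hik
  have htu := inB_mul ht hu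
  have h1 := rk_conj_left (u := u) hi hk hik
  suffices rk n (rf i k * u) < rk n u by omega
  have e1 := rk_add hu
  have e2 := rk_add htu
  suffices Module.finrank ℚ (Fx n u) < Module.finrank ℚ (Fx n (rf i k * u)) by omega
  apply Submodule.finrank_lt_finrank_of_lt
  have hle : Mv n (rf i k * u) ≤ Mv n u := by
    refine (Mv_mul _ _).trans (sup_le ((Mv_rf hi hk hik).trans ?_) le_rfl)
    rw [Submodule.span_singleton_le_iff_mem]; exact h
  refine lt_of_le_of_ne (Fx_anti htu hu hle) ?_
  intro heq
  have h' := h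
  rw [Mv_eq_range hu] at h'
  obtain ⟨v, hv⟩ := h'
  have hv' : rho n u v = v + (e n i - e n k) := by
    rw [← hv]; simp
  have hn0 : e n i - e n k ≠ 0 := fun h0 => hik (e_inj hi (sub_eq_zero.1 h0))
  have hnot : v ∉ Fx n u := by
    rw [mem_Fx, hv']; simpa using hn0
  apply hnot
  rw [heq, mem_Fx, rho_mul ht hu, hv']
  -- isometry
  have iso : ∀ a b : Fin n → ℚ, rho n u a ⬝ᵥ rho n u b = a ⬝ᵥ b := by
    intro a b
    rw [rho_apply u b, dotProduct_sum]
    simp only [dotProduct_smul, rho_dot_e hu, dot_pos]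
    simp [dotProduct, mul_comm]
  have hvv := iso v v
  rw [hv'] at hvv
  have hii := dot_self hi
  have hkk := dot_self hk
  have hc : e n k ⬝ᵥ e n i = e n i ⬝ᵥ e n k := dotProduct_comm _ _
  have hc1 : e n i ⬝ᵥ v = v ⬝ᵥ e n i := dotProduct_comm _ _
  have hc2 : e n k ⬝ᵥ v = v ⬝ᵥ e n k := dotProduct_comm _ _
  simp only [dotProduct_add, add_dotProduct, dotProduct_sub, sub_dotProduct, hii, hkk, hc, hc1, hc2] at hvv
  apply v_ext
  intro j hj
  have hj' := rho_dot_e ht (v + (e n i - e n k)) (rf i k j)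
  have hrr : rf i k (rf i k j) = j := by
    rw [← Equiv.Perm.mul_apply, rf_rf hi0 hk0 hik]; rfl
  rw [hrr] at hj'
  rw [hj']
  by_cases h1 : j = i
  · subst h1; rw [rf_left hi0 hk0]
    simp only [add_dotProduct, sub_dotProduct, hkk]; linarith
  by_cases h2 : j = -i
  · subst h2; rw [rf_nleft hi0 hk0 hik]
    simp only [e_neg, dotProduct_neg, add_dotProduct, sub_dotProduct, hkk]; linarith
  by_cases h3 : j = k
  · subst h3; rw [rf_right hi0 hk0]
    simp only [add_dotProduct, sub_dotProduct, hii, hc]; linarith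
  by_cases h4 : j = -k
  · subst h4; rw [rf_nright hi0 hk0 hik]
    simp only [e_neg, dotProduct_neg, add_dotProduct, sub_dotProduct, hii, hc]; linarith
  rw [rf_of_ne h1 h2 h3 h4, add_dotProduct, sub_dotProduct, dot_ne (Ne.symm h1) (by omega),
    dot_ne (Ne.symm h3) (by omega)]
  simp

lemma carter_right {u : Equiv.Perm ℤ} (hu : inB n u) {i k : ℤ} (hi : i ∈ signedSet n)
    (hk : k ∈ signedSet n) (hik : i ≠ k) (h : e n i - e n k ∈ Mv n u) :
    rk n (u * rf i k) + 1 = rk n u := by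
  have := carter_left (inB_inv hu) hi hk hik (by rwa [Mv_inv])
  rw [rk_inv, ← rk_inv, _root_.mul_inv_rev, inv_inv, rf_inv (S_ne hi) (S_ne hk) hik] at this
  exact this

lemma lenB_eq {w : Equiv.Perm ℤ} (hw : inB n w) : lenB n w = rk n w := by
  have key0 : ∀ r : ℕ, ∀ w : Equiv.Perm ℤ, inB n w → rk n w = r →
      ∃ l : List (Equiv.Perm ℤ), l.length = r ∧ (∀ g ∈ l, g ∈ genB n) ∧ l.prod = w := by
    intro r
    induction r with
    | zero =>
      intro w hw h
      exact ⟨[], rfl, by simp, by simp [eq_one_of_Mv hw h]⟩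
    | succ r ih =>
      intro w hw h
      have : ∃ i ∈ signedSet n, w i ≠ i := by
        by_contra hcon
        push Not at hcon
        have : w = 1 := by
          ext i
          by_cases hi : i ∈ signedSet n
          · exact hcon i hi
          · exact hw.2 i hi
        rw [this, rk_one] at h
        omega
      obtain ⟨i, hi, hwi⟩ := this
      have hk := (inB_mem hw).2 hi
      have hc := carter_left hw hi hk (Ne.symm hwi) (mem_Mv' w i)
      obtain ⟨l, h1, h2, h3⟩ := ih (rf i (w i) * w)
        (inB_mul (rf_inB hi hk (Ne.symm hwi)) hw) (by omega)
      refine ⟨rf i (w i) :: l, by simp [h1], ?_, ?_⟩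
      · intro g hg
        rcases List.mem_cons.1 hg with rfl | hg
        · exact rf_gen hi hk (Ne.symm hwi)
        · exact h2 g hg
      · rw [List.prod_cons, h3, ← mul_assoc, rf_rf (S_ne hi) (S_ne hk) (Ne.symm hwi), one_mul]
  apply le_antisymm
  · exact Nat.sInf_le (key0 _ w hw rfl)
  · have key : ∀ l : List (Equiv.Perm ℤ), (∀ g ∈ l, g ∈ genB n) → rk n l.prod ≤ l.length := by
      intro l
      induction l with
      | nil => intro _; simp [rk_one]
      | cons a l ih =>
        intro h
        obtain ⟨i, k, hi, hk, hik, rfl⟩ := gen_rf (h a (by simp))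
        rw [List.prod_cons, List.length_cons]
        have h1 := rk_mul (n := n) (rf i k) l.prod
        have h2 := rk_rf hi hk hik
        have h3 := ih (fun g hg => h g (by simp [hg]))
        omega
    apply le_csInf
    · obtain ⟨l, _, h1, h2⟩ := key0 _ w hw rfl
      exact ⟨l.length, l, rfl, h1, h2⟩
    · rintro k ⟨l, rfl, h1, rfl⟩
      exact key l h1

/-- absolute order -/
def le (n : ℕ) (x y : Equiv.Perm ℤ) : Prop := rk n y = rk n x + rk n (x⁻¹ * y)

lemma leB_iff {x y : Equiv.Perm ℤ} (hx : inB n x) (hy : inB n y) : leB n x y ↔ le n x y := by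
  rw [leB, le, lenB_eq hx, lenB_eq hy, lenB_eq (inB_mul (inB_inv hx) hy)]

lemma le_of {x y : Equiv.Perm ℤ} (h : rk n x + rk n (x⁻¹ * y) ≤ rk n y) : le n x y := by
  have := rk_mul (n := n) x (x⁻¹ * y)
  rw [mul_inv_cancel_left] at this
  exact le_antisymm this h

lemma le_tr {x y z : Equiv.Perm ℤ} (h1 : le n x y) (h2 : le n y z) : le n x z := by
  apply le_of
  have := rk_mul (n := n) (x⁻¹ * y) (y⁻¹ * z)
  rw [mul_assoc, mul_inv_cancel_left] at this
  unfold le at h1 h2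
  omega

lemma le_rfl' (x : Equiv.Perm ℤ) : le n x x := by
  apply le_of; simp [rk_one]

lemma one_le (x : Equiv.Perm ℤ) : le n 1 x := by
  apply le_of; simp [rk_one]

lemma le_Mv {x y : Equiv.Perm ℤ} (h : le n x y) : Mv n x ≤ Mv n y := by
  have h1 := Mv_mul (n := n) x (x⁻¹ * y)
  rw [mul_inv_cancel_left] at h1
  have h2 : Mv n y = Mv n x ⊔ Mv n (x⁻¹ * y) := by
    apply Submodule.eq_of_le_of_finrank_le h1
    refine (Submodule.finrank_add_le_finrank_add_finrank _ _).trans ?_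
    exact h.ge
  rw [h2]; exact le_sup_left

lemma rf_right_le {u : Equiv.Perm ℤ} (hu : inB n u) {i k : ℤ} (hi : i ∈ signedSet n)
    (hk : k ∈ signedSet n) (hik : i ≠ k) (h : e n i - e n k ∈ Mv n u) :
    le n (u * rf i k) u := by
  apply le_of
  have h1 := carter_right hu hi hk hik h
  have h2 : (u * rf i k)⁻¹ * u = rf i k := by
    rw [_root_.mul_inv_rev, inv_mul_cancel_right, rf_inv (S_ne hi) (S_ne hk) hik]
  rw [h2]
  have := rk_rf hi hk hik
  omega

/-- the interval -/
def T (n : ℕ) (g : Equiv.Perm ℤ) : Set (Equiv.Perm ℤ) := {w | inB n w ∧ le n w g}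

lemma le_of_Mv {g x y : Equiv.Perm ℤ} (hg : inB n g) (hgt : Mv n g = ⊤) (hx : x ∈ T n g)
    (hy : y ∈ T n g) (h : Mv n x ≤ Mv n y) : le n x y := by
  have hgn : rk n g = n := by rw [rk, hgt]; simp
  have hFg : Fx n g = ⊥ := by
    have := rk_add hg
    apply Submodule.finrank_eq_zero.1; omega
  have hinj : Function.Injective (rho n g - (LinearMap.id : (Fin n → ℚ) →ₗ[ℚ] (Fin n → ℚ))) := by
    rw [← LinearMap.ker_eq_bot]; exact hFg
  have hU : ∀ w ∈ T n g, Fx n (w⁻¹ * g) = (Mv n w).comap (rho n g - (LinearMap.id : (Fin n → ℚ) →ₗ[ℚ] (Fin n → ℚ))) := by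
    rintro w ⟨hw, hwg⟩
    have hz := inB_mul (inB_inv hw) hg
    apply Submodule.eq_of_le_of_finrank_le
    · intro v hv
      rw [mem_Fx] at hv
      rw [Submodule.mem_comap, Mv_eq_range hw]
      refine ⟨v, ?_⟩
      have : rho n g v = rho n w v := by
        conv_lhs => rw [← mul_inv_cancel_left w g, rho_mul hw hz, hv]
      simp [this]
    · have h1 := rk_add hz
      have h2 : Module.finrank ℚ ((Mv n w).comap (rho n g - (LinearMap.id : (Fin n → ℚ) →ₗ[ℚ] (Fin n → ℚ)))) ≤ rk n w := by
        apply LinearMap.finrank_le_finrank_of_injective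
          (f := (rho n g - (LinearMap.id : (Fin n → ℚ) →ₗ[ℚ] (Fin n → ℚ))).restrict (p := (Mv n w).comap (rho n g - (LinearMap.id : (Fin n → ℚ) →ₗ[ℚ] (Fin n → ℚ)))) (q := Mv n w) (fun v hv => hv))
        intro a b hab
        apply Subtype.ext
        apply hinj
        exact congrArg Subtype.val hab
      unfold le at hwg
      omega
  have hxz := inB_mul (inB_inv hx.1) hg
  have hyz := inB_mul (inB_inv hy.1) hg
  have hq := inB_mul (inB_inv hx.1) hy.1
  have hwv : ∀ w ∈ T n g, ∀ v ∈ Fx n (w⁻¹ * g), rho n g v = rho n w v := by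
    rintro w ⟨hw, hwg⟩ v hv
    rw [mem_Fx] at hv
    conv_lhs => rw [← mul_inv_cancel_left w g, rho_mul hw (inB_mul (inB_inv hw) hg), hv]
  have hinvv : ∀ v, rho n x⁻¹ (rho n x v) = v := by
    intro v
    rw [← rho_mul (inB_inv hx.1) hx.1, inv_mul_cancel, rho_one]
  have h1 : Fx n (x⁻¹ * g) ≤ Fx n (x⁻¹ * y) := by
    intro v hv
    have hv2 : v ∈ Fx n (y⁻¹ * g) := by
      rw [hU y hy]; rw [hU x hx] at hv
      exact h hv
    rw [mem_Fx, rho_mul (inB_inv hx.1) hy.1, ← hwv y hy v hv2, hwv x hx v hv, hinvv]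
  have h2 : Fx n y ≤ Fx n (x⁻¹ * y) := by
    intro v hv
    have hv2 := Fx_anti hx.1 hy.1 h hv
    rw [mem_Fx] at hv hv2
    rw [mem_Fx, rho_mul (inB_inv hx.1) hy.1, hv]
    conv_lhs => rw [← hv2]
    exact hinvv v
  have h3 : Disjoint (Fx n (x⁻¹ * g)) (Fx n y) := by
    rw [Submodule.disjoint_def]
    intro v hv hv'
    have hv2 := Fx_anti hx.1 hy.1 h hv'
    have h4 := hwv x hx v hv
    rw [mem_Fx] at hv2
    rw [hv2, ← mem_Fx, hFg] at h4
    simpa using h4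
  have h4 : Module.finrank ℚ (Fx n (x⁻¹ * g)) + Module.finrank ℚ (Fx n y) ≤
      Module.finrank ℚ (Fx n (x⁻¹ * y)) := by
    rw [← Submodule.finrank_sup_add_finrank_inf_eq, disjoint_iff.1 h3]
    simpa using Submodule.finrank_mono (sup_le h1 h2)
  have a1 := rk_add hxz
  have a2 := rk_add hy.1
  have a3 := rk_add hq
  have a4 := hx.2
  unfold le at a4
  apply le_of
  omega

lemma eq_of_Mv {g x y : Equiv.Perm ℤ} (hg : inB n g) (hgt : Mv n g = ⊤) (hx : x ∈ T n g)
    (hy : y ∈ T n g) (h : Mv n x = Mv n y) : x = y := by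
  have h1 := le_of_Mv hg hgt hx hy h.le
  unfold le at h1
  have h2 : rk n x = rk n y := by rw [rk, h]; rfl
  have h3 := eq_one_of_Mv (inB_mul (inB_inv hx.1) hy.1) (by omega)
  rw [inv_mul_eq_one] at h3
  exact h3

lemma rk_le_of_mem {u : Equiv.Perm ℤ} {i k : ℤ} (hi : i ∈ signedSet n)
    (hk : k ∈ signedSet n) (hik : i ≠ k) (h : e n i - e n k ∈ Mv n u) :
    Mv n (u * rf i k) ≤ Mv n u := by
  refine (Mv_mul _ _).trans (sup_le le_rfl ((Mv_rf hi hk hik).trans ?_))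
  rw [Submodule.span_singleton_le_iff_mem]; exact h

/-- the auxiliary step: from `x ≤ y` and `x i ≠ y i`, go up. -/
lemma step_up {x y : Equiv.Perm ℤ} (hx : inB n x) (hy : inB n y) (hxy : le n x y) {i : ℤ}
    (hi : i ∈ signedSet n) (hne : x i ≠ y i) :
    x⁻¹ (y i) ∈ signedSet n ∧ i ≠ x⁻¹ (y i) ∧ inB n (x * rf i (x⁻¹ (y i))) ∧
    rk n (x * rf i (x⁻¹ (y i))) = rk n x + 1 ∧ le n (x * rf i (x⁻¹ (y i))) y ∧
    le n x (x * rf i (x⁻¹ (y i))) := by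
  have hz := inB_mul (inB_inv hx) hy
  have hk : x⁻¹ (y i) ∈ signedSet n := (inB_mem hz).2 hi
  have hik : i ≠ x⁻¹ (y i) := by
    intro h
    apply hne
    rw [h, ai, ← h]
  set k := x⁻¹ (y i) with hkdef
  have hc := carter_left hz hi hk hik (mem_Mv' (x⁻¹ * y) i)
  have ht := rf_inB hi hk hik
  have hmul := rk_mul (n := n) (x * rf i k) (rf i k * (x⁻¹ * y))
  have hr := rf_rf (S_ne hi) (S_ne hk) hik
  have heq : (x * rf i k) * (rf i k * (x⁻¹ * y)) = y := by
    rw [mul_assoc, ← mul_assoc (rf i k), hr, one_mul, mul_inv_cancel_left]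
  have h1 := rk_mul (n := n) x (rf i k)
  have h2 := rk_rf hi hk hik
  rw [heq] at hmul
  unfold le at hxy
  have hrk : rk n (x * rf i k) = rk n x + 1 := by omega
  refine ⟨hk, hik, inB_mul hx ht, hrk, ?_, ?_⟩
  · apply le_of
    rw [_root_.mul_inv_rev, rf_inv (S_ne hi) (S_ne hk) hik, mul_assoc]
    omega
  · apply le_of
    rw [inv_mul_cancel_left]; omega

lemma fix_val {u y : Equiv.Perm ℤ} (hu : inB n u) (hy : inB n y) (huy : le n u y) {i : ℤ}
    (hi : i ∈ signedSet n) (h : e n i - e n (y i) ∈ Mv n u) : u i = y i := by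
  by_contra hne
  obtain ⟨hk, hik, _, hrk, _, _⟩ := step_up hu hy huy hi hne
  have h1 : e n i - e n (u⁻¹ (y i)) ∈ Mv n u := by
    have h2 := mem_Mv (n := n) u (u⁻¹ (y i))
    rw [ai] at h2
    have := add_mem h h2
    convert this using 1; abel
  have := carter_right hu hi hk hik h1
  omega

lemma join_up {x y : Equiv.Perm ℤ} (hx : inB n x) (hy : inB n y) (hxy : le n x y) {i : ℤ}
    (hi : i ∈ signedSet n) (h : e n i - e n (y i) ∉ Mv n x) :
    x⁻¹ (y i) ∈ signedSet n ∧ i ≠ x⁻¹ (y i) ∧ inB n (x * rf i (x⁻¹ (y i))) ∧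
    le n (x * rf i (x⁻¹ (y i))) y ∧ le n x (x * rf i (x⁻¹ (y i))) ∧
    (x * rf i (x⁻¹ (y i))) i = y i ∧
    Mv n (x * rf i (x⁻¹ (y i))) = Mv n x ⊔ Submodule.span ℚ {e n i - e n (y i)} := by
  have hne : x i ≠ y i := by
    intro h1; apply h; rw [← h1]; exact mem_Mv' x i
  obtain ⟨hk, hik, hB, hrk, h1, h2⟩ := step_up hx hy hxy hi hne
  have hv : (x * rf i (x⁻¹ (y i))) i = y i := by
    rw [Equiv.Perm.mul_apply, rf_left (S_ne hi) (S_ne hk), ai]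
  refine ⟨hk, hik, hB, h1, h2, hv, ?_⟩
  symm
  have hle : Mv n x ⊔ Submodule.span ℚ {e n i - e n (y i)} ≤ Mv n (x * rf i (x⁻¹ (y i))) := by
    refine sup_le (le_Mv h2) ?_
    rw [Submodule.span_singleton_le_iff_mem]
    have := mem_Mv' (n := n) (x * rf i (x⁻¹ (y i))) i
    rw [hv] at this
    exact this
  apply Submodule.eq_of_le_of_finrank_le hle
  have hlt : Mv n x < Mv n x ⊔ Submodule.span ℚ {e n i - e n (y i)} := by
    refine lt_of_le_of_ne le_sup_left ?_
    intro heq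
    apply h
    rw [heq]
    exact Submodule.mem_sup_right (Submodule.mem_span_singleton_self _)
  have := Submodule.finrank_lt_finrank_of_lt hlt
  unfold rk at hrk
  omega

end NB

namespace NB
variable {n : ℕ}

abbrev SC (w : Equiv.Perm ℤ) (a b : ℤ) : Prop := Equiv.Perm.SameCycle w a b

lemma inB_pow {w : Equiv.Perm ℤ} (hw : inB n w) (r : ℕ) : inB n (w ^ r) := by
  induction r with
  | zero => exact inB_one
  | succ r ih => rw [pow_succ]; exact inB_mul ih hw

lemma S_fin : (signedSet n).Finite := by
  apply (Set.finite_Icc (-(n:ℤ)) n).subset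
  intro i hi
  rw [mem_S] at hi
  exact hi.2

lemma B_fin : {w | inB n w}.Finite := by
  haveI : Finite (signedSet n) := S_fin
  apply Set.Finite.of_finite_image (f := fun w : Equiv.Perm ℤ => fun i : signedSet n => (w i))
  · apply (Set.Finite.pi (t := fun _ : signedSet n => signedSet n) (fun _ => S_fin)).subset
    rintro _ ⟨w, hw, rfl⟩
    intro i _
    exact (inB_mem hw).2 i.2
  · intro w hw v hv h
    ext i
    by_cases hi : i ∈ signedSet n
    · exact congrFun h ⟨i, hi⟩
    · rw [hw.2 i hi, hv.2 i hi]

lemma fin_ord {w : Equiv.Perm ℤ} (hw : inB n w) : ∃ N, 0 < N ∧ w ^ N = 1 := by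
  have : IsOfFinOrder w := by
    rw [← finite_powers]
    apply B_fin.subset
    rintro _ ⟨r, rfl⟩
    exact inB_pow hw r
  exact isOfFinOrder_iff_pow_eq_one.1 this

lemma SC_pow {w : Equiv.Perm ℤ} (r : ℕ) (a : ℤ) : SC w a ((w ^ r) a) := ⟨r, by simp⟩

lemma SC_nat {w : Equiv.Perm ℤ} (hw : inB n w) {a b : ℤ} (h : SC w a b) : ∃ r : ℕ, (w ^ r) a = b := by
  obtain ⟨N, hN, hN1⟩ := fin_ord hw
  obtain ⟨m, rfl⟩ := h
  refine ⟨(m % N).toNat, ?_⟩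
  have h0 : 0 ≤ m % N := Int.emod_nonneg _ (by omega)
  have h1 : w ^ m = w ^ (m % N) := by
    conv_lhs => rw [← Int.emod_add_mul_ediv m N, zpow_add, zpow_mul, zpow_natCast, hN1, one_zpow, mul_one]
  rw [h1]
  conv_rhs => rw [← Int.toNat_of_nonneg h0, zpow_natCast]

lemma pw_succ (w : Equiv.Perm ℤ) (r : ℕ) (a : ℤ) : (w ^ (r+1)) a = w ((w ^ r) a) := by
  rw [pow_succ']; rfl

lemma pw_add (w : Equiv.Perm ℤ) (r s : ℕ) (a : ℤ) : (w ^ (r+s)) a = (w ^ r) ((w ^ s) a) := by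
  rw [pow_add]; rfl

lemma pw_neg {w : Equiv.Perm ℤ} (hw : inB n w) (r : ℕ) (a : ℤ) : (w ^ r) (-a) = -(w ^ r) a :=
  (inB_pow hw r).1 a

lemma SC_neg {w : Equiv.Perm ℤ} (hw : inB n w) {a b : ℤ} (h : SC w a b) : SC w (-a) (-b) := by
  obtain ⟨r, rfl⟩ := SC_nat hw h
  rw [← pw_neg hw]; exact SC_pow r _

lemma SC_mem {w : Equiv.Perm ℤ} (hw : inB n w) {a b : ℤ} (h : SC w a b) (ha : a ∈ signedSet n) :
    b ∈ signedSet n := by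
  obtain ⟨r, rfl⟩ := SC_nat hw h
  exact (inB_mem (inB_pow hw r)).2 ha

/-- minimal period -/
noncomputable def mp (w : Equiv.Perm ℤ) (a : ℤ) : ℕ := Function.minimalPeriod w a

lemma per_iff (w : Equiv.Perm ℤ) (r : ℕ) (a : ℤ) : Function.IsPeriodicPt w r a ↔ (w ^ r) a = a := by
  rw [Function.IsPeriodicPt, Function.IsFixedPt, Equiv.Perm.iterate_eq_pow]

lemma mp_pos {w : Equiv.Perm ℤ} (hw : inB n w) (a : ℤ) : 0 < mp w a := by
  obtain ⟨N, hN, hN1⟩ := fin_ord hw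
  apply Function.IsPeriodicPt.minimalPeriod_pos hN
  rw [per_iff, hN1]; rfl

lemma mp_pow (w : Equiv.Perm ℤ) (a : ℤ) : (w ^ (mp w a)) a = a :=
  (per_iff _ _ _).1 (Function.isPeriodicPt_minimalPeriod w a)

lemma mp_le {w : Equiv.Perm ℤ} {a : ℤ} {r : ℕ} (hr : 0 < r) (h : (w ^ r) a = a) : mp w a ≤ r :=
  Function.IsPeriodicPt.minimalPeriod_le hr ((per_iff _ _ _).2 h)

lemma pw_cancel {w : Equiv.Perm ℤ} {r s : ℕ} {a b : ℤ} (h : (w ^ (r + s)) a = (w ^ r) b) :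
    (w ^ s) a = b := by
  rw [pw_add] at h
  exact (w ^ r).injective h

lemma mp_inj {w : Equiv.Perm ℤ} {a : ℤ} {r s : ℕ} (hr : 1 ≤ r) (hrs : r < s) (hs : s ≤ mp w a) :
    (w ^ r) a ≠ (w ^ s) a := by
  intro h
  obtain ⟨d, rfl⟩ := Nat.exists_eq_add_of_lt hrs
  have := pw_cancel (w := w) (r := r) (s := d+1) (a := a) (b := a) h.symm
  have := mp_le (by omega) this
  omega

lemma mp_eq {w : Equiv.Perm ℤ} {a : ℤ} {m : ℕ} (hm : 0 < m) (h : (w ^ m) a = a)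
    (h2 : ∀ r, 1 ≤ r → r < m → (w ^ r) a ≠ a) : mp w a = m := by
  apply le_antisymm (mp_le hm h)
  by_contra hlt
  push Not at hlt
  refine h2 (mp w a) ?_ hlt (mp_pow w a)
  exact Function.IsPeriodicPt.minimalPeriod_pos hm ((per_iff _ _ _).2 h)

lemma SC_mp {w : Equiv.Perm ℤ} (hw : inB n w) {a b : ℤ} (h : SC w a b) :
    ∃ r, 1 ≤ r ∧ r ≤ mp w a ∧ (w ^ r) a = b := by
  obtain ⟨r, rfl⟩ := SC_nat hw h
  have h0 := mp_pos hw a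
  have key : ∀ q r, (w ^ (r + mp w a * q)) a = (w ^ r) a := by
    intro q
    induction q with
    | zero => simp
    | succ q ih =>
      intro r
      rw [show r + mp w a * (q+1) = r + mp w a * q + mp w a by ring, pw_add, mp_pow, ih]
  by_cases hr : r % mp w a = 0
  · refine ⟨mp w a, h0, le_rfl, ?_⟩
    rw [mp_pow]
    have := key (r / mp w a) 0
    rw [zero_add] at this
    rw [Nat.mul_div_cancel' (Nat.dvd_of_mod_eq_zero hr)] at this
    rw [this]; rfl
  · refine ⟨r % mp w a, by omega, (Nat.mod_lt _ h0).le, ?_⟩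
    conv_rhs => rw [← Nat.mod_add_div r (mp w a), key]

lemma mp_SC {w : Equiv.Perm ℤ} {a b : ℤ} (h : SC w a b) : mp w a = mp w b := by
  obtain ⟨m, rfl⟩ := h
  rw [mp, mp, Function.minimalPeriod_eq_minimalPeriod_iff]
  intro r
  rw [per_iff, per_iff, ← zpow_natCast, ← Equiv.Perm.mul_apply, ← zpow_add, add_comm, zpow_add,
    Equiv.Perm.mul_apply, EmbeddingLike.apply_eq_iff_eq]

lemma mp_neg {w : Equiv.Perm ℤ} (hw : inB n w) (a : ℤ) : mp w (-a) = mp w a := by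
  rw [mp, mp, Function.minimalPeriod_eq_minimalPeriod_iff]
  intro r
  rw [per_iff, per_iff, pw_neg hw, neg_inj]

/-- explicit cycle -/
lemma cyc {x : Equiv.Perm ℤ} (hx : inB n x) (c : ℕ → ℤ) {m : ℕ} (hm : 1 ≤ m)
    (h1 : ∀ r, 1 ≤ r → r < m → x (c r) = c (r+1)) (h2 : x (c m) = c 1)
    (h3 : ∀ r s, 1 ≤ r → r < s → s ≤ m → c r ≠ c s) :
    mp x (c m) = m ∧ (∀ r, 1 ≤ r → r ≤ m → SC x (c m) (c r)) ∧
    (∀ b, SC x (c m) b → ∃ r, 1 ≤ r ∧ r ≤ m ∧ b = c r) := by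
  have hp : ∀ r, 1 ≤ r → r ≤ m → (x ^ r) (c m) = c r := by
    intro r
    induction r with
    | zero => omega
    | succ r ih =>
      intro _ hr
      rw [pw_succ]
      rcases Nat.eq_zero_or_pos r with rfl | h0
      · simpa using h2
      · rw [ih h0 (by omega), h1 r h0 (by omega)]
  have hmp : mp x (c m) = m := by
    apply mp_eq hm (hp m hm le_rfl)
    intro r hr hrm
    rw [hp r hr hrm.le]
    exact h3 r m hr hrm le_rfl
  refine ⟨hmp, ?_, ?_⟩
  · intro r hr hrm
    rw [← hp r hr hrm]; exact SC_pow _ _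
  · intro b hb
    obtain ⟨r, hr, hrm, rfl⟩ := SC_mp hx hb
    rw [hmp] at hrm
    exact ⟨r, hr, hrm, hp r hr hrm⟩

/-- away from the reflection -/
lemma away {u : Equiv.Perm ℤ} (hu : inB n u) {i k a : ℤ} (hx : inB n (u * rf i k))
    (h1 : ¬ SC u a i) (h2 : ¬ SC u a (-i)) (h3 : ¬ SC u a k) (h4 : ¬ SC u a (-k)) :
    (∀ b, SC (u * rf i k) a b ↔ SC u a b) ∧ mp (u * rf i k) a = mp u a := by
  have hp : ∀ r : ℕ, ((u * rf i k) ^ r) a = (u ^ r) a := by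
    intro r
    induction r with
    | zero => rfl
    | succ r ih =>
      have hs := SC_pow (w := u) r a
      rw [pw_succ, pw_succ, ih, Equiv.Perm.mul_apply, rf_of_ne]
      · rintro h; rw [h] at hs; exact h1 hs
      · rintro h; rw [h] at hs; exact h2 hs
      · rintro h; rw [h] at hs; exact h3 hs
      · rintro h; rw [h] at hs; exact h4 hs
  constructor
  · intro b
    constructor
    · intro h
      obtain ⟨r, rfl⟩ := SC_nat hx h
      rw [hp]; exact SC_pow _ _
    · intro h
      obtain ⟨r, rfl⟩ := SC_nat hu h
      rw [← hp]; exact SC_pow _ _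
  · rw [mp, mp, Function.minimalPeriod_eq_minimalPeriod_iff]
    intro r
    rw [per_iff, per_iff, hp]

/-- basic splitting -/
lemma split {u : Equiv.Perm ℤ} {i : ℤ} {m : ℕ} (hm : 1 ≤ m)
    (hi : i ∈ signedSet n) (hk : (u ^ m) i ∈ signedSet n) (hx : inB n (u * rf i ((u ^ m) i)))
    (h1 : ∀ r, 1 ≤ r → r < m → (u ^ r) i ≠ i ∧ (u ^ r) i ≠ -i ∧ (u ^ r) i ≠ (u ^ m) i ∧ (u ^ r) i ≠ -(u ^ m) i) :
    mp (u * rf i ((u ^ m) i)) ((u ^ m) i) = m ∧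
    (∀ r, 1 ≤ r → r ≤ m → SC (u * rf i ((u ^ m) i)) ((u ^ m) i) ((u ^ r) i)) ∧
    (∀ b, SC (u * rf i ((u ^ m) i)) ((u ^ m) i) b → ∃ r, 1 ≤ r ∧ r ≤ m ∧ b = (u ^ r) i) := by
  refine cyc hx (fun r => (u ^ r) i) hm ?_ ?_ ?_
  · intro r hr hrm
    obtain ⟨a, b, c, d⟩ := h1 r hr hrm
    simp only [Equiv.Perm.mul_apply]
    rw [rf_of_ne a b c d, pw_succ]
  · simp only [Equiv.Perm.mul_apply]
    rw [rf_right (S_ne hi) (S_ne hk), pow_one]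
  · intro r s hr hrs hsm h
    obtain ⟨d, rfl⟩ := Nat.exists_eq_add_of_lt hrs
    have h5 := pw_cancel (w := u) (r := r) (s := d+1) (a := i) (b := i) h.symm
    exact (h1 (d+1) (by omega) (by omega)).1 h5

end NB

namespace NB
open Matrix
variable {n : ℕ}

lemma SC_Mv {w : Equiv.Perm ℤ} (hw : inB n w) {a b : ℤ} (h : SC w a b) : e n a - e n b ∈ Mv n w := by
  obtain ⟨r, rfl⟩ := SC_nat hw h
  clear h
  induction r with
  | zero => simp
  | succ r ih =>
    rw [pw_succ]
    have := add_mem ih (mem_Mv' (n := n) w ((w ^ r) a))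
    convert this using 1; abel

/-- zero element -/
abbrev Zr (w : Equiv.Perm ℤ) (a : ℤ) : Prop := SC w a (-a)

lemma Zr_Mv {w : Equiv.Perm ℤ} (hw : inB n w) {a : ℤ} (h : Zr w a) : e n a ∈ Mv n w := by
  have h1 := SC_Mv hw h
  rw [e_neg] at h1
  have := Submodule.smul_mem _ (1/2 : ℚ) h1
  convert this using 1
  module

open Classical in
lemma Mv_SC {w : Equiv.Perm ℤ} (hw : inB n w) {i k : ℤ} (hi : i ∈ signedSet n)
    (hk : k ∈ signedSet n) (h0 : ¬ Zr w i) (h : e n i - e n k ∈ Mv n w) : SC w i k := by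
  let v : Fin n → ℚ := fun j => (if SC w i ((j:ℤ)+1) then 1 else 0) - (if SC w i (-((j:ℤ)+1)) then 1 else 0)
  have hv : ∀ j ∈ signedSet n, v ⬝ᵥ e n j = (if SC w i j then 1 else 0) - (if SC w i (-j) then 1 else 0) := by
    intro j hj
    obtain ⟨k, rfl | rfl⟩ := S_cases hj
    · rw [dot_pos]
    · rw [e_neg, dotProduct_neg, dot_pos, neg_neg]; simp only [v]; ring
  have hM : ∀ m ∈ Mv n w, v ⬝ᵥ m = 0 := by
    intro m hm
    induction hm using Submodule.span_induction with
    | mem x hx =>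
      obtain ⟨j, rfl⟩ := hx
      by_cases hj : j ∈ signedSet n
      · simp only [dotProduct_sub]
        rw [hv j hj, hv _ ((inB_mem hw).2 hj), ← hw.1]
        simp only [SC, Equiv.Perm.sameCycle_apply_right]; ring
      · simp [hw.2 j hj]
    | zero => simp
    | add x y _ _ h1 h2 => simp [dotProduct_add, h1, h2]
    | smul a x _ h => simp [dotProduct_smul, h]
  have := hM _ h
  rw [dotProduct_sub, hv i hi, hv k hk, if_pos (Equiv.Perm.SameCycle.refl _ _), if_neg h0] at this
  by_contra hc
  rw [if_neg hc] at this
  split_ifs at this <;> norm_num at this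

lemma Mv_Zr {w : Equiv.Perm ℤ} (hw : inB n w) {i : ℤ} (hi : i ∈ signedSet n) (h : e n i ∈ Mv n w) :
    Zr w i := by
  by_contra h0
  apply h0
  apply Mv_SC hw hi (neg_S.2 hi) h0
  rw [e_neg, sub_neg_eq_add]; exact add_mem h h

lemma Zr_iff {w : Equiv.Perm ℤ} (hw : inB n w) {i : ℤ} (hi : i ∈ signedSet n) :
    Zr w i ↔ e n i ∈ Mv n w := ⟨Zr_Mv hw, Mv_Zr hw hi⟩

lemma Zr_SC {w : Equiv.Perm ℤ} (hw : inB n w) {a b : ℤ} (h : SC w a b) (ha : Zr w a) : Zr w b :=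
  (h.symm.trans ha).trans (SC_neg hw h)

lemma Zr_neg {w : Equiv.Perm ℤ} {a : ℤ} (ha : Zr w a) : Zr w (-a) := by
  rw [Zr, neg_neg]; exact ha.symm

lemma Mv_iff {w : Equiv.Perm ℤ} (hw : inB n w) {i k : ℤ} (hi : i ∈ signedSet n)
    (hk : k ∈ signedSet n) : e n i - e n k ∈ Mv n w ↔ SC w i k ∨ (Zr w i ∧ Zr w k) := by
  constructor
  · intro h
    by_cases h0 : Zr w i
    · right
      refine ⟨h0, Mv_Zr hw hk ?_⟩
      have := sub_mem (Zr_Mv hw h0) h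
      simpa using this
    · exact Or.inl (Mv_SC hw hi hk h0 h)
  · rintro (h | ⟨h1, h2⟩)
    · exact SC_Mv hw h
    · exact sub_mem (Zr_Mv hw h1) (Zr_Mv hw h2)

def blk (n : ℕ) (w : Equiv.Perm ℤ) (i : ℤ) : Set ℤ := {k | k ∈ signedSet n ∧ e n i - e n k ∈ Mv n w}

lemma neg_orb {w : Equiv.Perm ℤ} (hw : inB n w) (i : ℤ) :
    negSet (permOrbit w i) = permOrbit w i ↔ Zr w i := by
  constructor
  · intro h
    have : i ∈ permOrbit w i := ⟨0, rfl⟩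
    rw [← h] at this
    exact this
  · intro h
    ext b
    constructor
    · intro hb
      have h1 : SC w i (-b) := hb
      have := SC_neg hw h1
      rw [neg_neg] at this
      exact Equiv.Perm.SameCycle.trans h this
    · intro hb
      have h1 : SC w i b := hb
      exact Equiv.Perm.SameCycle.trans h (SC_neg hw h1)

lemma blk_orb {w : Equiv.Perm ℤ} (hw : inB n w) {i : ℤ} (hi : i ∈ signedSet n) (h0 : ¬ Zr w i) :
    blk n w i = permOrbit w i := by
  ext k
  constructor
  · rintro ⟨hk, h⟩; exact Mv_SC hw hi hk h0 h
  · intro h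
    exact ⟨SC_mem hw h hi, SC_Mv hw h⟩

lemma blk_zero {w : Equiv.Perm ℤ} (hw : inB n w) {i : ℤ} (hi : i ∈ signedSet n) (h0 : Zr w i) :
    blk n w i = ⋃₀ {A | A ∈ orbitsOn n w ∧ negSet A = A} := by
  ext k
  constructor
  · rintro ⟨hk, h⟩
    have hz : Zr w k := by
      rcases (Mv_iff hw hi hk).1 h with h | h
      · exact Zr_SC hw h h0
      · exact h.2
    exact ⟨permOrbit w k, ⟨⟨k, hk, rfl⟩, (neg_orb hw k).2 hz⟩, ⟨0, rfl⟩⟩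
  · rintro ⟨A, ⟨⟨j, hj, rfl⟩, hA⟩, hk⟩
    have hz := (neg_orb hw j).1 hA
    have hjk : SC w j k := hk
    have hkS := SC_mem hw hjk hj
    exact ⟨hkS, (Mv_iff hw hi hkS).2 (Or.inr ⟨h0, Zr_SC hw hjk hz⟩)⟩

lemma omega_eq {w : Equiv.Perm ℤ} (hw : inB n w) :
    omegaTilde n w = {A | ∃ i ∈ signedSet n, A = blk n w i} := by
  ext A
  constructor
  · rintro (⟨⟨i, hi, rfl⟩, hA⟩ | ⟨hA, hne⟩)
    · rw [Ne, neg_orb hw] at hA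
      exact ⟨i, hi, (blk_orb hw hi hA).symm⟩
    · obtain ⟨b, hb⟩ := hne
      rw [hA] at hb
      obtain ⟨C, ⟨⟨i, hi, rfl⟩, hC⟩, _⟩ := hb
      exact ⟨i, hi, by rw [hA, blk_zero hw hi ((neg_orb hw i).1 hC)]⟩
  · rintro ⟨i, hi, rfl⟩
    by_cases h0 : Zr w i
    · right
      refine ⟨blk_zero hw hi h0, ⟨i, hi, by simp⟩⟩
    · left
      rw [blk_orb hw hi h0]
      exact ⟨⟨i, hi, rfl⟩, fun h => h0 ((neg_orb hw i).1 h)⟩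

lemma ref_iff {x y : Equiv.Perm ℤ} (hx : inB n x) (hy : inB n y) :
    refines (omegaTilde n x) (omegaTilde n y) ↔ Mv n x ≤ Mv n y := by
  rw [omega_eq hx, omega_eq hy]
  constructor
  · intro h
    refine Mv_le (fun i hi => ?_) hx
    obtain ⟨B, ⟨j, hj, rfl⟩, hB⟩ := h _ ⟨i, hi, rfl⟩
    have h1 : i ∈ blk n x i := ⟨hi, by simp⟩
    have h2 : x i ∈ blk n x i := ⟨(inB_mem hx).2 hi, mem_Mv' x i⟩
    have := sub_mem (hB h1).2 (hB h2).2
    convert this using 1; abel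
  · rintro h _ ⟨i, hi, rfl⟩
    exact ⟨_, ⟨i, hi, rfl⟩, fun k hk => ⟨hk.1, h hk.2⟩⟩

lemma omega_Mv {x y : Equiv.Perm ℤ} (hx : inB n x) (hy : inB n y)
    (h : omegaTilde n x = omegaTilde n y) : Mv n x = Mv n y := by
  apply le_antisymm
  · rw [← ref_iff hx hy, h]; exact fun A hA => ⟨A, hA, le_rfl⟩
  · rw [← ref_iff hy hx, h]; exact fun A hA => ⟨A, hA, le_rfl⟩

lemma omega_one : omegaTilde n 1 = botNCB n := by
  rw [omega_eq inB_one]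
  ext A
  have : ∀ i ∈ signedSet n, blk n 1 i = {i} := by
    intro i hi
    ext k
    simp only [blk, Mv_one, Submodule.mem_bot, sub_eq_zero, Set.mem_ofPred_eq, Set.mem_singleton_iff]
    constructor
    · rintro ⟨hk, h⟩; exact (e_inj hi h).symm
    · rintro rfl; exact ⟨hi, rfl⟩
  constructor
  · rintro ⟨i, hi, rfl⟩; exact ⟨i, hi, this i hi⟩
  · rintro ⟨i, hi, rfl⟩; exact ⟨i, hi, (this i hi).symm⟩

lemma omega_top {g : Equiv.Perm ℤ} (hg : inB n g) (hgt : Mv n g = ⊤) (hn : 1 ≤ n) :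
    omegaTilde n g = topNCB n := by
  rw [omega_eq hg]
  have hb : ∀ i, blk n g i = signedSet n := by
    intro i; ext k; simp [blk, hgt]
  ext A
  constructor
  · rintro ⟨i, hi, rfl⟩; exact hb i
  · intro h
    exact ⟨1, by rw [mem_S]; omega, by rw [hb]; exact h⟩

end NB

namespace NB
variable {n : ℕ}

def gl (p : ℕ) : List ℤ := ((List.range p).map fun i : ℕ => ((i : ℤ) + 1)) ++
      ((List.range p).map fun i : ℕ => -((i : ℤ) + 1))

lemma gl_len (p : ℕ) : (gl p).length = 2 * p := by simp [gl]; omega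

lemma gl_mem {p : ℕ} {i : ℤ} : i ∈ gl p ↔ i ∈ signedSet p := by
  rw [mem_S]
  simp only [gl, List.mem_append, List.mem_map, List.mem_range]
  constructor
  · rintro (⟨a, ha, rfl⟩ | ⟨a, ha, rfl⟩) <;> omega
  · rintro h
    rcases lt_or_gt_of_ne h.1 with h0 | h0
    · exact Or.inr ⟨(-i-1).toNat, by omega, by omega⟩
    · exact Or.inl ⟨(i-1).toNat, by omega, by omega⟩

lemma gl_get1 {p r : ℕ} (h : r < p) (h' : r < (gl p).length) : (gl p)[r] = r + 1 := by
  simp only [gl]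
  rw [List.getElem_append_left (by simpa using h)]
  simp

lemma gl_get2 {p r : ℕ} (h : p ≤ r) (h' : r < (gl p).length) : (gl p)[r] = -((r:ℤ) - p + 1) := by
  simp only [gl]
  rw [List.getElem_append_right (by simpa using h)]
  simp [h]

lemma gl_nodup (p : ℕ) : (gl p).Nodup := by
  rw [gl, List.nodup_append]
  refine ⟨?_, ?_, ?_⟩
  · apply List.Nodup.map _ List.nodup_range
    intro a b h; simpa using h
  · apply List.Nodup.map _ List.nodup_range
    intro a b h; simpa using h
  · simp only [List.mem_map]
    rintro a ⟨b, _, rfl⟩ c ⟨d, _, rfl⟩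
    omega

lemma gl_step {p : ℕ} {i : ℤ} (h1 : 1 ≤ i) (h2 : i < p) : (gl p).formPerm i = i + 1 := by
  have hl := gl_len p
  have := List.formPerm_apply_lt_getElem (gl p) (gl_nodup p) (i-1).toNat (by omega)
  rw [gl_get1 (by omega), gl_get1 (by omega)] at this
  rw [show (((i-1).toNat : ℕ) : ℤ) + 1 = i by omega] at this
  rw [this]; omega

lemma gl_step' {p : ℕ} {i : ℤ} (h1 : 1 ≤ i) (h2 : i < p) : (gl p).formPerm (-i) = -(i + 1) := by
  have hl := gl_len p
  have := List.formPerm_apply_lt_getElem (gl p) (gl_nodup p) (p+(i-1).toNat) (by omega)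
  rw [gl_get2 (by omega), gl_get2 (by omega)] at this
  rw [show -(((p+(i-1).toNat : ℕ) : ℤ) - p + 1) = -i by omega] at this
  rw [this]; omega

lemma gl_last {p : ℕ} (h1 : 1 ≤ p) : (gl p).formPerm p = -1 := by
  have hl := gl_len p
  have := List.formPerm_apply_lt_getElem (gl p) (gl_nodup p) (p-1) (by omega)
  rw [gl_get1 (by omega), gl_get2 (by omega)] at this
  rw [show ((p-1 : ℕ) : ℤ) + 1 = p by omega] at this
  rw [this]; omega

lemma gl_last' {p : ℕ} (h1 : 1 ≤ p) : (gl p).formPerm (-p) = 1 := by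
  have hl := gl_len p
  have := List.formPerm_apply_getElem (gl p) (gl_nodup p) (2*p-1) (by omega)
  simp only [hl, show 2 * p - 1 + 1 = 2*p by omega, Nat.mod_self] at this
  rw [gl_get2 (by omega), gl_get1 (by omega)] at this
  rw [show -(((2*p-1 : ℕ) : ℤ) - p + 1) = -p by omega] at this
  rw [this]; simp

lemma gl_out {p : ℕ} {i : ℤ} (h : i ∉ signedSet p) : (gl p).formPerm i = i :=
  List.formPerm_apply_of_notMem (by rwa [gl_mem])

lemma coe_list (l : List ℕ) : (do let a ← l; pure (a:ℤ)) = l.map (fun a : ℕ => (a:ℤ)) := by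
  induction l with
  | nil => rfl
  | cons a l ih => simpa using ih

lemma gam_eq (p : ℕ) : gammaPQ p 1 = (gl p).formPerm * Equiv.swap ((p:ℤ)+1) (-((p:ℤ)+1)) := by
  rw [gammaPQ, gl]
  simp only [coe_list, List.map_map]
  simp [List.range_succ, Function.comp_def]

lemma gam_n (p : ℕ) : gammaPQ p 1 ((p:ℤ)+1) = -((p:ℤ)+1) := by
  rw [gam_eq, Equiv.Perm.mul_apply, Equiv.swap_apply_left, gl_out]
  rw [mem_S]; omega

lemma gam_n' (p : ℕ) : gammaPQ p 1 (-((p:ℤ)+1)) = (p:ℤ)+1 := by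
  rw [gam_eq, Equiv.Perm.mul_apply, Equiv.swap_apply_right, gl_out]
  rw [mem_S]; omega

lemma gam_o {p : ℕ} {i : ℤ} (h1 : i ≠ (p:ℤ)+1) (h2 : i ≠ -((p:ℤ)+1)) :
    gammaPQ p 1 i = (gl p).formPerm i := by
  rw [gam_eq, Equiv.Perm.mul_apply, Equiv.swap_apply_of_ne_of_ne h1 h2]

lemma gam_inB {p : ℕ} (hp : 1 ≤ p) : inB (p+1) (gammaPQ p 1) := by
  constructor
  · intro i
    by_cases h1 : i = (p:ℤ)+1
    · rw [h1, gam_n, gam_n', neg_neg]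
    by_cases h2 : i = -((p:ℤ)+1)
    · rw [h2, neg_neg, gam_n, gam_n']
    rw [gam_o (by omega) (by omega), gam_o h1 h2]
    by_cases h : i ∈ signedSet p
    · rw [mem_S] at h
      by_cases h3 : i = p
      · rw [h3, gl_last hp, gl_last' hp, neg_neg]
      by_cases h4 : i = -p
      · rw [h4, neg_neg, gl_last hp, gl_last' hp]
      by_cases h5 : 0 < i
      · rw [gl_step' (by omega) (by omega), gl_step (by omega) (by omega)]
      · have a := gl_step (p := p) (i := -i) (by omega) (by omega)
        have b := gl_step' (p := p) (i := -i) (by omega) (by omega)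
        rw [neg_neg] at b
        rw [a, b, neg_neg]
    · rw [gl_out h, gl_out (by rwa [neg_S])]
  · intro i hi
    rw [mem_S] at hi
    push_cast at hi
    rw [gam_o, gl_out]
    · rw [mem_S]; omega
    · omega
    · omega

lemma gam_pow {p : ℕ} {r : ℕ} (hr : r < p) : ((gammaPQ p 1) ^ r) 1 = (r:ℤ) + 1 := by
  induction r with
  | zero => simp
  | succ r ih =>
    rw [pw_succ, ih (by omega), gam_o (by omega) (by omega), gl_step (by omega) (by omega)]
    push_cast; ring

lemma gam_powp {p : ℕ} (hp : 1 ≤ p) : ((gammaPQ p 1) ^ p) 1 = -1 := by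
  obtain ⟨r, rfl⟩ : ∃ r, p = r + 1 := ⟨p-1, by omega⟩
  rw [pw_succ, gam_pow (by omega), gam_o (by push_cast; omega) (by push_cast; omega)]
  have := gl_last (p := r+1) (by omega)
  push_cast at this
  exact this

lemma gam_Zr {p : ℕ} (hp : 1 ≤ p) {i : ℤ} (hi : i ∈ signedSet (p+1)) : Zr (gammaPQ p 1) i := by
  have h1 : Zr (gammaPQ p 1) 1 := by
    have := SC_pow (w := gammaPQ p 1) p 1
    rwa [gam_powp hp] at this
  have key : ∀ i : ℤ, 1 ≤ i → i ≤ p+1 → Zr (gammaPQ p 1) i := by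
    intro i hi hi2
    by_cases h : i = p+1
    · have := SC_pow (w := gammaPQ p 1) 1 i
      rw [pow_one, h, gam_n, ← h] at this
      exact this
    · have := SC_pow (w := gammaPQ p 1) (i-1).toNat 1
      rw [gam_pow (by omega), show (((i-1).toNat:ℕ):ℤ) + 1 = i by omega] at this
      exact Zr_SC (gam_inB hp) this h1
  rw [mem_S] at hi
  push_cast at hi
  rcases lt_or_gt_of_ne hi.1 with h0 | h0
  · have := Zr_neg (key (-i) (by omega) (by omega))
    rwa [neg_neg] at this
  · exact key i (by omega) (by omega)

lemma gam_Mv {p : ℕ} (hp : 1 ≤ p) : Mv (p+1) (gammaPQ p 1) = ⊤ := by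
  rw [eq_top_iff]
  intro v _
  have : v = ∑ k, v k • e (p+1) ((k:ℤ)+1) := by
    simp only [e_pos]
    funext j
    simp [Finset.sum_apply, Pi.single_apply]
  rw [this]
  refine Submodule.sum_mem _ fun k _ => Submodule.smul_mem _ _ ?_
  exact Zr_Mv (gam_inB hp) (gam_Zr hp (pos_S k))

lemma gam_SC {p : ℕ} (hp : 1 ≤ p) {i : ℤ} (hi : i ∈ signedSet p) : SC (gammaPQ p 1) 1 i := by
  have h1 : Zr (gammaPQ p 1) 1 := by
    have := SC_pow (w := gammaPQ p 1) p 1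
    rwa [gam_powp hp] at this
  have key : ∀ i : ℤ, 1 ≤ i → i ≤ p → SC (gammaPQ p 1) 1 i := by
    intro i hi hi2
    have := SC_pow (w := gammaPQ p 1) (i-1).toNat 1
    rw [gam_pow (by omega), show (((i-1).toNat:ℕ):ℤ) + 1 = i by omega] at this
    exact this
  rw [mem_S] at hi
  rcases lt_or_gt_of_ne hi.1 with h0 | h0
  · have := SC_neg (gam_inB hp) (key (-i) (by omega) (by omega))
    rw [neg_neg] at this
    exact Equiv.Perm.SameCycle.trans h1 this
  · exact key i (by omega) (by omega)

end NB

namespace NB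
variable {n : ℕ}

structure ZC (n : ℕ) (u : Equiv.Perm ℤ) (i : ℤ) (h : ℕ) : Prop where
  B : inB n u
  hi : i ∈ signedSet n
  h1 : 1 ≤ h
  hh : (u ^ h) i = -i
  dist : ∀ r s, 1 ≤ r → r < s → s ≤ h → (u ^ r) i ≠ (u ^ s) i ∧ (u ^ r) i ≠ -(u ^ s) i

lemma pw_S {u : Equiv.Perm ℤ} (hu : inB n u) {i : ℤ} (hi : i ∈ signedSet n) (r : ℕ) :
    (u ^ r) i ∈ signedSet n := (inB_mem (inB_pow hu r)).2 hi

lemma ZC_ex {u : Equiv.Perm ℤ} (hu : inB n u) {i : ℤ} (hi : i ∈ signedSet n) (hz : Zr u i) :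
    ∃ h, ZC n u i h := by
  classical
  have hi0 := S_ne hi
  have hex : ∃ r, (u ^ r) i = -i := SC_nat hu hz
  have hmin : ∀ d, d < Nat.find hex → (u ^ d) i ≠ -i := fun d hd => Nat.find_min hex hd
  have hh := Nat.find_spec hex
  set h := Nat.find hex
  have h1 : 1 ≤ h := by
    by_contra hlt
    have : h = 0 := by omega
    rw [this] at hh
    simp at hh; omega
  refine ⟨h, hu, hi, h1, hh, ?_⟩
  intro r s hr hrs hsh
  obtain ⟨d, rfl⟩ := Nat.exists_eq_add_of_lt hrs
  constructor
  · intro heq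
    have h5 := pw_cancel (w := u) (r := r) (s := d+1) (a := i) (b := i) heq.symm
    obtain ⟨q, hq⟩ := Nat.exists_eq_add_of_le (show d + 1 ≤ h by omega)
    have h6 : (u ^ q) i = -i := by
      rw [hq, add_comm, pw_add, h5] at hh; exact hh
    exact hmin q (by omega) h6
  · intro heq
    have h5 := pw_cancel (w := u) (r := r) (s := d+1) (a := i) (b := -i)
      (by rw [pw_neg hu, heq, neg_neg]; rfl)
    exact hmin (d+1) (by omega) h5

lemma ZC.Zr {u : Equiv.Perm ℤ} {i : ℤ} {h : ℕ} (Z : ZC n u i h) : Zr u i := by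
  have := SC_pow (w := u) h i
  rwa [Z.hh] at this

lemma ZC.ne {u : Equiv.Perm ℤ} {i : ℤ} {h : ℕ} (Z : ZC n u i h) {r : ℕ} (h1 : 1 ≤ r) (h2 : r < h) :
    (u ^ r) i ≠ i ∧ (u ^ r) i ≠ -i := by
  have := Z.dist r h h1 h2 le_rfl
  rw [Z.hh, neg_neg] at this
  exact ⟨this.2, this.1⟩

lemma ZC.ne' {u : Equiv.Perm ℤ} {i : ℤ} {h : ℕ} (Z : ZC n u i h) {r : ℕ} (h1 : 1 ≤ r) (h2 : r ≤ h) :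
    (u ^ r) i ≠ i := by
  have hi0 := S_ne Z.hi
  rcases h2.lt_or_eq with h3 | h3
  · exact (Z.ne h1 h3).1
  · rw [h3, Z.hh]; omega

lemma ZC.ex {u : Equiv.Perm ℤ} {i : ℤ} {h : ℕ} (Z : ZC n u i h) {b : ℤ} (hb : SC u i b) :
    ∃ r, 1 ≤ r ∧ r ≤ h ∧ (b = (u ^ r) i ∨ b = -(u ^ r) i) := by
  obtain ⟨r, h1, h2, rfl⟩ := SC_mp Z.B hb
  have hm : mp u i ≤ h + h := by
    apply mp_le (by have := Z.h1; omega)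
    rw [pw_add, Z.hh, pw_neg Z.B, Z.hh, neg_neg]
  by_cases hr : r ≤ h
  · exact ⟨r, h1, hr, Or.inl rfl⟩
  · obtain ⟨q, rfl⟩ := Nat.exists_eq_add_of_le (show h ≤ r by omega)
    refine ⟨q, by omega, by omega, Or.inr ?_⟩
    rw [add_comm, pw_add, Z.hh, pw_neg Z.B]

lemma ZC.neg {u : Equiv.Perm ℤ} {i : ℤ} {h : ℕ} (Z : ZC n u i h) : ZC n u (-i) h := by
  refine ⟨Z.B, neg_S.2 Z.hi, Z.h1, by rw [pw_neg Z.B, Z.hh], ?_⟩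
  intro r s h1 h2 h3
  have := Z.dist r s h1 h2 h3
  simp only [pw_neg Z.B]
  omega

lemma ZC.pw {u : Equiv.Perm ℤ} {i : ℤ} {h : ℕ} (Z : ZC n u i h) (m : ℕ) : ZC n u ((u ^ m) i) h := by
  have key : ∀ r, (u ^ r) ((u ^ m) i) = (u ^ m) ((u ^ r) i) := by
    intro r; rw [← pw_add, add_comm, pw_add]
  refine ⟨Z.B, pw_S Z.B Z.hi m, Z.h1, by rw [key, Z.hh, pw_neg Z.B], ?_⟩
  intro r s h1 h2 h3
  have := Z.dist r s h1 h2 h3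
  rw [key, key, ← pw_neg Z.B]
  simpa using this

/-- case B -/
lemma caseB {u : Equiv.Perm ℤ} {i : ℤ} {h m : ℕ} (Z : ZC n u i h) (hm : 1 ≤ m) (hmh : m ≤ h) :
    inB n (u * rf i ((u ^ m) i)) ∧
    mp (u * rf i ((u ^ m) i)) ((u ^ m) i) = m ∧
    (∀ r, 1 ≤ r → r ≤ m → SC (u * rf i ((u ^ m) i)) ((u ^ m) i) ((u ^ r) i)) ∧
    (∀ b, SC (u * rf i ((u ^ m) i)) ((u ^ m) i) b → ∃ r, 1 ≤ r ∧ r ≤ m ∧ b = (u ^ r) i) ∧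
    ¬ Zr (u * rf i ((u ^ m) i)) ((u ^ m) i) ∧
    (∀ r, m < r → r ≤ h → SC (u * rf i ((u ^ m) i)) i ((u ^ r) i)) ∧
    (∀ a, ¬ SC u i a → (∀ b, SC (u * rf i ((u ^ m) i)) a b ↔ SC u a b) ∧
      mp (u * rf i ((u ^ m) i)) a = mp u a) := by
  have hi0 := S_ne Z.hi
  have hkS := pw_S Z.B Z.hi m
  have hk0 := S_ne hkS
  have hik := Z.ne' hm hmh
  have hx : inB n (u * rf i ((u ^ m) i)) := inB_mul Z.B (rf_inB Z.hi hkS hik.symm)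
  obtain ⟨s1, s2, s3⟩ := split (n := n) (u := u) (i := i) (m := m) hm Z.hi hkS hx (by
    intro r h1 h2
    have a := Z.ne h1 (by omega)
    have b := Z.dist r m h1 h2 hmh
    exact ⟨a.1, a.2, b.1, b.2⟩)
  refine ⟨hx, s1, s2, s3, ?_, ?_, ?_⟩
  · intro hz
    obtain ⟨r, h1, h2, h3⟩ := s3 _ hz
    rcases h2.lt_or_eq with h4 | h4
    · exact (Z.dist r m h1 h4 hmh).2 h3.symm
    · rw [h4] at h3; omega
  · intro r
    induction r with
    | zero => omega
    | succ r ih =>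
      intro h1 h2
      have hstep : (u * rf i ((u ^ m) i)) ((u ^ r) i) = (u ^ (r+1)) i ∨ m = r := by
        by_cases hmr : m = r
        · exact Or.inr hmr
        · left
          have a := Z.ne (r := r) (by omega) (by omega)
          have b := Z.dist m r hm (by omega) (by omega)
          rw [Equiv.Perm.mul_apply, rf_of_ne a.1 a.2 b.1.symm (by have := b.2; omega), pw_succ]
      rcases hstep with hs | hs
      · by_cases hmr : m = r
        · have : (u * rf i ((u ^ m) i)) i = (u ^ (r+1)) i := by
            rw [Equiv.Perm.mul_apply, rf_left hi0 hk0, pw_succ, hmr]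
          rw [← this]
          exact (Equiv.Perm.SameCycle.refl _ _).apply_right
        · have := ih (by omega) (by omega)
          rw [← hs]
          exact this.apply_right
      · have : (u * rf i ((u ^ m) i)) i = (u ^ (r+1)) i := by
          rw [Equiv.Perm.mul_apply, rf_left hi0 hk0, pw_succ, hs]
        rw [← this]
        exact (Equiv.Perm.SameCycle.refl _ _).apply_right
  · intro a ha
    have hk := SC_pow (w := u) m i
    apply away Z.B hx
    · exact fun h => ha h.symm
    · exact fun h => ha (Z.Zr.trans h.symm)
    · exact fun h => ha (hk.trans h.symm)
    · exact fun h => ha ((hk.trans (Zr_SC Z.B hk Z.Zr)).trans h.symm)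

/-- case C -/
lemma caseC {u : Equiv.Perm ℤ} {i k : ℤ} {h : ℕ} (Z : ZC n u i h) (hk : k ∈ signedSet n)
    (huk : u k = -k) (hne : ∀ r, (u ^ r) i ≠ k ∧ (u ^ r) i ≠ -k) :
    inB n (u * rf i k) ∧ mp (u * rf i k) i = h + 1 ∧
    SC (u * rf i k) i (-k) ∧
    (∀ r, 1 ≤ r → r ≤ h → SC (u * rf i k) i (-(u ^ r) i)) ∧
    ¬ Zr (u * rf i k) i ∧
    (∀ a, ¬ SC u i a → a ≠ k → a ≠ -k → (∀ b, SC (u * rf i k) a b ↔ SC u a b) ∧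
      mp (u * rf i k) a = mp u a) := by
  have hi0 := S_ne Z.hi
  have hk0 := S_ne hk
  have hne0 := hne 0
  simp only [pow_zero, Equiv.Perm.one_apply] at hne0
  have hik := hne0.1
  have hx : inB n (u * rf i k) := inB_mul Z.B (rf_inB Z.hi hk hik)
  let c : ℕ → ℤ := fun r => if r = 1 then -k else -(u ^ (r-1)) i
  have hc1 : c 1 = -k := rfl
  have hc2 : ∀ r, 1 ≤ r → c (r+1) = -(u ^ r) i := by
    intro r hr; simp only [c]; rw [if_neg (by omega)]; rfl
  have hcm : c (h+1) = i := by rw [hc2 h Z.h1, Z.hh, neg_neg]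
  obtain ⟨s1, s2, s3⟩ := cyc hx c (m := h+1) (by omega) (by
    intro r h1 h2
    rcases h1.lt_or_eq with h3 | h3
    · obtain ⟨q, rfl⟩ : ∃ q, r = q + 1 := ⟨r-1, by omega⟩
      have a := Z.ne (r := q) (by omega) (by omega)
      have b := hne q
      rw [hc2 q (by omega), hc2 (q+1) (by omega), hx.1, Equiv.Perm.mul_apply, rf_of_ne a.1 a.2 b.1 b.2, pw_succ]
    · subst h3
      rw [hc1, hc2 1 le_rfl, hx.1, Equiv.Perm.mul_apply, rf_right hi0 hk0, pow_one]) (by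
    rw [hcm, hc1, Equiv.Perm.mul_apply, rf_left hi0 hk0, huk]) (by
    intro r s h1 h2 h3
    obtain ⟨t, rfl⟩ : ∃ t, s = t + 1 := ⟨s-1, by omega⟩
    rw [hc2 t (by omega)]
    rcases h1.lt_or_eq with h4 | h4
    · obtain ⟨q, rfl⟩ : ∃ q, r = q + 1 := ⟨r-1, by omega⟩
      rw [hc2 q (by omega)]
      have := Z.dist q t (by omega) (by omega) (by omega)
      omega
    · subst h4
      rw [hc1]; have := hne t; omega)
  rw [hcm] at s1 s2 s3
  refine ⟨hx, s1, ?_, ?_, ?_, ?_⟩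
  · have := s2 1 le_rfl (by omega); rwa [hc1] at this
  · intro r h1 h2
    have := s2 (r+1) (by omega) (by omega); rwa [hc2 r h1] at this
  · intro hz
    obtain ⟨r, h1, h2, h3⟩ := s3 _ hz
    rcases h1.lt_or_eq with h4 | h4
    · obtain ⟨q, rfl⟩ : ∃ q, r = q + 1 := ⟨r-1, by omega⟩
      rw [hc2 q (by omega)] at h3
      have := Z.ne' (r := q) (by omega) (by omega)
      omega
    · subst h4; rw [hc1] at h3; omega
  · intro a ha h1 h2
    have hka : ∀ r, (u ^ r) k = k ∨ (u ^ r) k = -k := by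
      intro r
      induction r with
      | zero => left; rfl
      | succ r ih =>
        rw [pw_succ]
        rcases ih with h | h
        · right; rw [h, huk]
        · left; rw [h, Z.B.1, huk, neg_neg]
    have hka' : ¬ SC u a k := by
      intro h
      obtain ⟨r, h3⟩ := SC_nat Z.B h.symm
      have := hka r
      omega
    apply away Z.B hx
    · exact fun h => ha h.symm
    · exact fun h => ha (Z.Zr.trans h.symm)
    · exact hka'
    · intro h
      apply hka'
      have h3 : SC u k (-k) := by rw [← huk]; exact (Equiv.Perm.SameCycle.refl _ _).apply_right
      exact h.trans h3.symm

/-- case A -/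
lemma caseA {u : Equiv.Perm ℤ} (hu : inB n u) {i : ℤ} (hi : i ∈ signedSet n) (hz : ¬ Zr u i) {m : ℕ}
    (hm : 1 ≤ m) (hmL : m < mp u i) :
    inB n (u * rf i ((u ^ m) i)) ∧
    mp (u * rf i ((u ^ m) i)) ((u ^ m) i) = m ∧
    (∀ r, 1 ≤ r → r ≤ m → SC (u * rf i ((u ^ m) i)) ((u ^ m) i) ((u ^ r) i)) ∧
    (∀ b, SC (u * rf i ((u ^ m) i)) ((u ^ m) i) b → ∃ r, 1 ≤ r ∧ r ≤ m ∧ b = (u ^ r) i) ∧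
    mp (u * rf i ((u ^ m) i)) i = mp u i - m ∧
    (∀ r, m < r → r ≤ mp u i → SC (u * rf i ((u ^ m) i)) i ((u ^ r) i)) ∧
    (∀ b, SC (u * rf i ((u ^ m) i)) i b → ∃ r, m < r ∧ r ≤ mp u i ∧ b = (u ^ r) i) ∧
    (∀ a, ¬ SC u i a → ¬ SC u i (-a) → (∀ b, SC (u * rf i ((u ^ m) i)) a b ↔ SC u a b) ∧
      mp (u * rf i ((u ^ m) i)) a = mp u a) := by
  have hi0 := S_ne hi
  have hkS := pw_S hu hi m
  have hk0 := S_ne hkS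
  have hpL := mp_pow u i
  have hin : ∀ r s, 1 ≤ r → r < s → s ≤ mp u i → (u ^ r) i ≠ (u ^ s) i := fun r s a b c => mp_inj a b c
  have hng : ∀ r s, (u ^ r) i ≠ -(u ^ s) i := by
    intro r s h
    apply hz
    have h1 := SC_pow (w := u) r i
    have h2 := SC_neg hu (SC_pow (w := u) s i)
    rw [← h] at h2
    exact h1.trans h2.symm
  have hni : ∀ r, (u ^ r) i ≠ -i := fun r => hng r 0
  have hik : i ≠ (u ^ m) i := by
    have := hin m (mp u i) hm hmL le_rfl
    rw [hpL] at this; exact this.symm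
  have hx : inB n (u * rf i ((u ^ m) i)) := inB_mul hu (rf_inB hi hkS hik)
  obtain ⟨s1, s2, s3⟩ := split (n := n) (u := u) (i := i) (m := m) hm hi hkS hx (by
    intro r h1 h2
    refine ⟨?_, hni r, hin r m h1 h2 (by omega), hng r m⟩
    have := hin r (mp u i) h1 (by omega) le_rfl
    rwa [hpL] at this)
  have hadd : ∀ r, (u ^ r) ((u ^ m) i) = (u ^ (r + m)) i := fun r => (pw_add u r m i).symm
  have hback : (u ^ (mp u i - m)) ((u ^ m) i) = i := by
    rw [hadd, show mp u i - m + m = mp u i by omega, hpL]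
  have hsp := split (n := n) (u := u) (i := (u ^ m) i) (m := mp u i - m) (by omega) hkS
    (by rw [hback]; exact hi) (by rw [hback, rf_comm hk0 hi0 hik.symm]; exact hx) (by
      intro r h1 h2
      rw [hback, hadd]
      refine ⟨(hin m (r+m) hm (by omega) (by omega)).symm, hng _ _, ?_, hni _⟩
      have := hin (r+m) (mp u i) (by omega) (by omega) le_rfl
      rwa [hpL] at this)
  rw [hback, rf_comm hk0 hi0 hik.symm] at hsp
  obtain ⟨t1, t2, t3⟩ := hsp
  refine ⟨hx, s1, s2, s3, t1, ?_, ?_, ?_⟩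
  · intro r h1 h2
    have := t2 (r-m) (by omega) (by omega)
    rwa [hadd, show r - m + m = r by omega] at this
  · intro b hb
    obtain ⟨r, h1, h2, h3⟩ := t3 b hb
    exact ⟨r+m, by omega, by omega, by rw [h3, hadd]⟩
  · intro a ha ha'
    have hk := SC_pow (w := u) m i
    apply away hu hx
    · exact fun h => ha h.symm
    · intro h
      have := SC_neg hu h
      rw [neg_neg] at this
      exact ha' this.symm
    · exact fun h => ha (hk.trans h.symm)
    · intro h
      have := SC_neg hu h
      rw [neg_neg] at this
      exact ha' (hk.trans this.symm)

end NB

namespace NB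
variable {n : ℕ}

def Out (n : ℕ) (a : ℤ) : Prop := a ∈ signedSet n ∧ a ≠ n ∧ a ≠ -n

structure Nice (n : ℕ) (u : Equiv.Perm ℤ) : Prop where
  pos : 1 ≤ n
  B : inB n u
  nz : Zr u n → u n = -n
  one : ∀ a b, Out n a → Out n b → Zr u a → Zr u b → SC u a b

lemma n_S (hn : 1 ≤ n) : (n:ℤ) ∈ signedSet n := by rw [mem_S]; omega

lemma swap_orb {u : Equiv.Perm ℤ} (hu : inB n u) {k : ℤ} (huk : u k = -k) {b : ℤ} (h : SC u k b) :
    b = k ∨ b = -k := by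
  obtain ⟨r, rfl⟩ := SC_nat hu h
  clear h
  induction r with
  | zero => left; rfl
  | succ r ih =>
    rw [pw_succ]
    rcases ih with h | h
    · right; rw [h, huk]
    · left; rw [h, hu.1, huk, neg_neg]

lemma Nice.zout {u : Equiv.Perm ℤ} (N : Nice n u) {i : ℤ} (hi : Out n i) (hz : Zr u i) {b : ℤ}
    (h : SC u i b) : b ≠ n ∧ b ≠ -n := by
  have key : ¬ SC u i n := by
    intro h
    have h1 := N.nz (Zr_SC N.B h hz)
    have h2 := swap_orb N.B h1 h.symm
    rcases h2 with h2 | h2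
    · exact hi.2.1 h2
    · exact hi.2.2 h2
  constructor
  · rintro rfl; exact key h
  · rintro rfl
    have := SC_neg N.B h
    rw [neg_neg] at this
    exact key (Equiv.Perm.SameCycle.trans hz this)

lemma Nice.cases {u : Equiv.Perm ℤ} (N : Nice n u) {i k : ℤ} (hi : Out n i) (hk : k ∈ signedSet n)
    (hik : i ≠ k) (h : e n i - e n k ∈ Mv n u) :
    (¬ Zr u i ∧ ∃ m, 1 ≤ m ∧ m < mp u i ∧ k = (u ^ m) i) ∨
    (∃ h m, ZC n u i h ∧ 1 ≤ m ∧ m ≤ h ∧ k = (u ^ m) i) ∨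
    (∃ h m, ZC n u k h ∧ Out n k ∧ 1 ≤ m ∧ m < h ∧ i = (u ^ m) k) ∨
    (∃ h, ZC n u i h ∧ Zr u n ∧ (k = n ∨ k = -n)) := by
  by_cases hz : Zr u i
  · right
    have hkz : Zr u k := by
      rcases (Mv_iff N.B hi.1 hk).1 h with h | h
      · exact Zr_SC N.B h hz
      · exact h.2
    obtain ⟨h, Z⟩ := ZC_ex N.B hi.1 hz
    by_cases hk1 : k = n
    · right; right; exact ⟨h, Z, by rw [← hk1]; exact hkz, Or.inl hk1⟩
    by_cases hk2 : k = -n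
    · right; right
      refine ⟨h, Z, ?_, Or.inr hk2⟩
      have := Zr_neg hkz
      rwa [hk2, neg_neg] at this
    have hko : Out n k := ⟨hk, hk1, hk2⟩
    obtain ⟨r, h1, h2, h3⟩ := Z.ex (N.one i k hi hko hz hkz)
    rcases h3 with h3 | h3
    · left; exact ⟨h, r, Z, h1, h2, h3⟩
    · right; left
      have hrh : r < h := by
        rcases h2.lt_or_eq with h4 | h4
        · exact h4
        · exfalso; apply hik; rw [h3, h4, Z.hh, neg_neg]
      refine ⟨h, h - r, ?_, hko, by omega, by omega, ?_⟩
      · rw [h3]; exact (Z.pw r).neg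
      · rw [h3, pw_neg N.B, ← pw_add, show h - r + r = h by omega, Z.hh, neg_neg]
  · left
    refine ⟨hz, ?_⟩
    obtain ⟨r, h1, h2, h3⟩ := SC_mp N.B (Mv_SC N.B hi.1 hk hz h)
    refine ⟨r, h1, ?_, h3.symm⟩
    rcases h2.lt_or_eq with h4 | h4
    · exact h4
    · exfalso; apply hik; rw [← h3, h4, mp_pow]

lemma Nice.oneB {u : Equiv.Perm ℤ} (N : Nice n u) {i : ℤ} {h m : ℕ} (hi : Out n i) (Z : ZC n u i h)
    (hm : 1 ≤ m) (hmh : m ≤ h)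
    (hzz : ∀ a, Out n a → Zr (u * rf i ((u ^ m) i)) a → Zr u a) :
    ∀ a, Out n a → Zr (u * rf i ((u ^ m) i)) a → SC (u * rf i ((u ^ m) i)) i a := by
  obtain ⟨hx, b1, b2, b3, b4, b5, b6⟩ := caseB Z hm hmh
  intro a ha haz
  obtain ⟨r, h1, h2, h3⟩ := Z.ex (N.one i a hi ha Z.Zr (hzz a ha haz))
  have hrz : Zr (u * rf i ((u ^ m) i)) ((u ^ r) i) := by
    rcases h3 with h3 | h3
    · rw [← h3]; exact haz
    · have := Zr_neg haz
      rwa [h3, neg_neg] at this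
  by_cases hrm : r ≤ m
  · exact absurd (Zr_SC hx (b2 r h1 hrm).symm hrz) b4
  · have := b5 r (by omega) h2
    rcases h3 with h3 | h3
    · rw [h3]; exact this
    · rw [h3]; exact this.trans hrz

lemma Nice.oneC {u : Equiv.Perm ℤ} (N : Nice n u) {i k : ℤ} {h : ℕ} (hi : Out n i) (Z : ZC n u i h)
    (hnz : Zr u n) (hk : k = n ∨ k = -n) :
    k ∈ signedSet n ∧ u k = -k ∧ (∀ r, (u ^ r) i ≠ k ∧ (u ^ r) i ≠ -k) := by
  have hS := n_S N.pos
  have h1 := N.nz hnz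
  have key : ∀ r, (u ^ r) i ≠ n ∧ (u ^ r) i ≠ -n := fun r => N.zout hi Z.Zr (SC_pow r i)
  rcases hk with rfl | rfl
  · exact ⟨hS, h1, key⟩
  · refine ⟨neg_S.2 hS, by rw [N.B.1, h1], fun r => ?_⟩
    have := key r
    rw [neg_neg]; exact this.symm

lemma Nice.step {u : Equiv.Perm ℤ} (N : Nice n u) {i k : ℤ} (hi : Out n i) (hk : k ∈ signedSet n)
    (hik : i ≠ k) (h : e n i - e n k ∈ Mv n u) (a b : ℤ) (ha : Out n a) (hb : Out n b)
    (haz : Zr (u * rf i k) a) (hbz : Zr (u * rf i k) b) : SC (u * rf i k) a b := by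
  have hx : inB n (u * rf i k) := inB_mul N.B (rf_inB hi.1 hk hik)
  have hM := rk_le_of_mem hi.1 hk hik h
  have hzz : ∀ a, Out n a → Zr (u * rf i k) a → Zr u a := fun a ha hz =>
    Mv_Zr N.B ha.1 (hM (Zr_Mv hx hz))
  rcases N.cases hi hk hik h with ⟨hz, m, h1, h2, rfl⟩ | ⟨h, m, Z, h1, h2, rfl⟩ | ⟨h, m, Z, hko, h1, h2, h3⟩ | ⟨h, Z, hnz, hkn⟩
  · obtain ⟨_, _, _, _, _, _, _, hw⟩ := caseA N.B hi.1 hz h1 h2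
    have hau := hzz a ha haz
    have h3 : ¬ SC u i a := fun h => hz (Zr_SC N.B h.symm hau)
    rw [(hw a h3 (fun h => h3 (h.trans hau.symm))).1 b]
    exact N.one a b ha hb hau (hzz b hb hbz)
  · have := N.oneB hi Z h1 h2 hzz
    exact (this a ha haz).symm.trans (this b hb hbz)
  · rw [rf_comm (S_ne hi.1) (S_ne hk) hik] at *
    subst h3
    have := N.oneB hko Z h1 h2.le hzz
    exact (this a ha haz).symm.trans (this b hb hbz)
  · obtain ⟨c1, c2, c3⟩ := N.oneC hi Z hnz hkn
    obtain ⟨_, _, _, d2, d3, _⟩ := caseC Z c1 c2 c3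
    exfalso
    apply d3
    obtain ⟨r, h1, h2, h3⟩ := Z.ex (N.one i a hi ha Z.Zr (hzz a ha haz))
    have := d2 r h1 h2
    rcases h3 with h3 | h3
    · rw [← h3] at this
      exact Zr_SC hx this.symm (Zr_neg haz)
    · rw [← h3] at this
      exact Zr_SC hx this.symm haz

lemma T_nz {p : ℕ} (hp : 1 ≤ p) {w : Equiv.Perm ℤ} (hw : w ∈ T (p+1) (gammaPQ p 1))
    (h : Zr w ((p+1:ℕ):ℤ)) : w ((p+1:ℕ):ℤ) = -((p+1:ℕ):ℤ) := by
  have hg : gammaPQ p 1 ((p+1:ℕ):ℤ) = -((p+1:ℕ):ℤ) := by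
    have := gam_n p
    push_cast; exact this
  rw [fix_val hw.1 (gam_inB hp) hw.2 (n_S (by omega)), hg]
  rw [hg]; exact SC_Mv hw.1 h

lemma T_one {p : ℕ} (hp : 1 ≤ p) : ∀ d : ℕ, ∀ w ∈ T (p+1) (gammaPQ p 1), p + 1 ≤ rk (p+1) w + d →
    ∀ a b, Out (p+1) a → Out (p+1) b → Zr w a → Zr w b → SC w a b := by
  have hgB := gam_inB hp
  have hgo : ∀ a, Out (p+1) a → Out (p+1) (gammaPQ p 1 a) := by
    intro a ha
    refine ⟨(inB_mem hgB).2 ha.1, ?_, ?_⟩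
    · intro h
      have := gam_n' p
      push_cast at h
      rw [← this, EmbeddingLike.apply_eq_iff_eq] at h
      exact ha.2.2 (by push_cast; exact h)
    · intro h
      have := gam_n p
      push_cast at h
      rw [← this, EmbeddingLike.apply_eq_iff_eq] at h
      exact ha.2.1 (by push_cast; exact h)
  have base : ∀ w, inB (p+1) w → (∀ i, Out (p+1) i → w i = gammaPQ p 1 i) →
      ∀ a, Out (p+1) a → SC w 1 a := by
    intro w hw hwi a ha
    have ha' : a ∈ signedSet p := by
      have h1 := ha.1
      have h2 := ha.2
      rw [mem_S] at h1 ⊢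
      push_cast at h1 h2
      omega
    obtain ⟨r, rfl⟩ := SC_nat hgB (gam_SC hp ha')
    have key : ∀ r : ℕ, (w ^ r) 1 = ((gammaPQ p 1) ^ r) 1 ∧ Out (p+1) (((gammaPQ p 1) ^ r) 1) := by
      intro r
      induction r with
      | zero =>
        refine ⟨rfl, ?_, ?_, ?_⟩
        · rw [mem_S]; simp; omega
        · simp; omega
        · simp; omega
      | succ r ih =>
        rw [pw_succ, pw_succ, ih.1, hwi _ ih.2]
        exact ⟨rfl, hgo _ ih.2⟩
    rw [← (key r).1]; exact SC_pow _ _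
  intro d
  induction d with
  | zero =>
    intro w hw hr a b ha hb _ _
    have : w = gammaPQ p 1 := by
      apply eq_of_Mv hgB (gam_Mv hp) hw ⟨hgB, le_rfl' _⟩
      rw [gam_Mv hp]
      apply Submodule.eq_top_of_finrank_eq
      have h1 : rk (p+1) w ≤ p + 1 := by have := rk_add hw.1; omega
      have : rk (p+1) w = p + 1 := by omega
      rw [rk] at this
      rw [this]; simp
    have hb2 := base w hw.1 (fun i _ => by rw [this])
    exact (hb2 a ha).symm.trans (hb2 b hb)
  | succ d ih =>
    intro w hw hr a b ha hb haz hbz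
    by_cases hall : ∀ i, Out (p+1) i → w i = gammaPQ p 1 i
    · have hb2 := base w hw.1 hall
      exact (hb2 a ha).symm.trans (hb2 b hb)
    · push Not at hall
      obtain ⟨i, hi, hne⟩ := hall
      obtain ⟨hk, hik, hB, hrk, hle, hle2⟩ := step_up hw.1 hgB hw.2 hi.1 hne
      set k := w⁻¹ (gammaPQ p 1 i) with hkd
      have hT : w * rf i k ∈ T (p+1) (gammaPQ p 1) := ⟨hB, hle⟩
      have N : Nice (p+1) (w * rf i k) := ⟨by omega, hB, T_nz hp hT, ih _ hT (by omega)⟩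
      have hmem : e (p+1) i - e (p+1) k ∈ Mv (p+1) (w * rf i k) := by
        have h1 := mem_Mv' (n := p+1) (w * rf i k) i
        rw [Equiv.Perm.mul_apply, rf_left (S_ne hi.1) (S_ne hk)] at h1
        have h2 := le_Mv hle2 (mem_Mv (n := p+1) w k)
        have := add_mem h1 h2
        convert this using 1; abel
      have hw2 : w = w * rf i k * rf i k := by
        rw [mul_assoc, rf_rf (S_ne hi.1) (S_ne hk) hik, mul_one]
      have := N.step hi hk hik hmem a b ha hb
      rw [← hw2] at this
      exact this haz hbz

lemma T_nice {p : ℕ} (hp : 1 ≤ p) {w : Equiv.Perm ℤ} (hw : w ∈ T (p+1) (gammaPQ p 1)) :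
    Nice (p+1) w :=
  ⟨by omega, hw.1, T_nz hp hw, T_one hp (p+1) w hw (by omega)⟩

end NB

namespace NB
variable {n : ℕ}
open Classical

noncomputable def D (n : ℕ) (w : Equiv.Perm ℤ) (i : ℤ) : Finset ℤ :=
  (Finset.Icc 1 (n:ℤ)).filter (fun b => SC w i b ∨ SC w i (-b))

noncomputable def aa (j : ℕ) : ℚ := (-1)^(j-1) * (catalan (j-1) : ℚ)
noncomputable def mm (h : ℕ) : ℚ := if h = 0 then 1 else (-1)^h * (Nat.centralBinom h : ℚ) / 2
noncomputable def gg (h : ℕ) : ℚ := if h = 0 then -1 else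
  (-1)^(h+1) * (5/2 * (Nat.centralBinom h : ℚ) - 2 * (catalan h : ℚ))

noncomputable def term (w : Equiv.Perm ℤ) (b : ℤ) : ℚ :=
  if Zr w b then 1 else if ∀ c, SC w b c → b ≤ |c| then aa (mp w b) else 1

noncomputable def Zo (n : ℕ) (w : Equiv.Perm ℤ) : Finset ℤ :=
  (Finset.Icc 1 (n:ℤ)).filter (fun b => b ≠ n ∧ Zr w b)

noncomputable def psi (n : ℕ) (w : Equiv.Perm ℤ) (h : ℕ) : ℚ := if Zr w n then gg h else mm h

noncomputable def F (n : ℕ) (w : Equiv.Perm ℤ) : ℚ :=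
  psi n w (Zo n w).card * ∏ b ∈ Finset.Icc 1 (n:ℤ), term w b

lemma mem_D {w : Equiv.Perm ℤ} {i b : ℤ} : b ∈ D n w i ↔ (1 ≤ b ∧ b ≤ n) ∧ (SC w i b ∨ SC w i (-b)) := by
  rw [D, Finset.mem_filter, Finset.mem_Icc]

lemma Icc_S {b : ℤ} (h : 1 ≤ b ∧ b ≤ n) : b ∈ signedSet n := by rw [mem_S]; omega

lemma abs_S {b : ℤ} (h : b ∈ signedSet n) : 1 ≤ |b| ∧ |b| ≤ n := by
  rw [mem_S] at h
  have := abs_cases b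
  omega

lemma prodD {w : Equiv.Perm ℤ} (hw : inB n w) {i : ℤ} (hi : i ∈ signedSet n) (hz : ¬ Zr w i) :
    ∏ b ∈ D n w i, term w b = aa (mp w i) := by
  have habs : ∀ c, SC w i c → |c| ∈ D n w i := by
    intro c hc
    rw [mem_D]
    refine ⟨abs_S (SC_mem hw hc hi), ?_⟩
    rcases abs_choice c with h | h
    · rw [h]; exact Or.inl hc
    · rw [h, neg_neg]; exact Or.inr hc
  have hne : (D n w i).Nonempty := ⟨_, habs i (Equiv.Perm.SameCycle.refl _ _)⟩
  have hmem := Finset.min'_mem _ hne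
  have hmin := fun c hc => Finset.min'_le (D n w i) c hc
  set b0 := (D n w i).min' hne
  have hnz : ∀ b ∈ D n w i, ¬ Zr w b := by
    intro b hb hbz
    rw [mem_D] at hb
    rcases hb.2 with h | h
    · exact hz (Zr_SC hw h.symm hbz)
    · exact hz (Zr_SC hw h.symm (Zr_neg hbz))
  rw [Finset.prod_eq_single b0]
  · rw [term, if_neg (hnz b0 hmem)]
    rw [mem_D] at hmem
    have hcond : ∀ c, SC w b0 c → b0 ≤ |c| := by
      intro c hc
      apply hmin
      rcases hmem.2 with h | h
      · exact habs _ (h.trans hc)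
      · have := habs _ (h.trans (SC_neg hw hc))
        rwa [abs_neg] at this
    rw [if_pos hcond]
    rcases hmem.2 with h | h
    · rw [mp_SC h]
    · rw [mp_SC h, mp_neg hw]
  · intro b hb hbne
    rw [term, if_neg (hnz b hb), if_neg]
    intro hcon
    apply hbne
    apply le_antisymm _ (hmin b hb)
    rw [mem_D] at hb hmem
    have hab : |b0| = b0 := abs_of_pos (by omega)
    have hor : SC w b b0 ∨ SC w b (-b0) := by
      rcases hb.2 with h | h <;> rcases hmem.2 with h' | h'
      · exact Or.inl (h.symm.trans h')
      · exact Or.inr (h.symm.trans h')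
      · right
        have := SC_neg hw (h.symm.trans h')
        rwa [neg_neg] at this
      · left
        have := SC_neg hw (h.symm.trans h')
        rwa [neg_neg, neg_neg] at this
    rcases hor with h | h
    · have := hcon _ h; rwa [hab] at this
    · have := hcon _ h; rwa [abs_neg, hab] at this
  · intro h; exact absurd hmem h

lemma term_away {x u : Equiv.Perm ℤ} {b : ℤ} (h1 : ∀ c, SC x b c ↔ SC u b c) (h2 : mp x b = mp u b) :
    term x b = term u b := by
  simp only [term, Zr, h1, h2]

lemma card_orb {u : Equiv.Perm ℤ} {i : ℤ} {h : ℕ} (Z : ZC n u i h) {m : ℕ} {X : Finset ℤ}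
    (hX : ∀ b, b ∈ X ↔ 1 ≤ b ∧ ∃ r, m < r ∧ r ≤ h ∧ (b = (u ^ r) i ∨ b = -(u ^ r) i)) :
    X.card = h - m := by
  have : X = (Finset.Ioc m h).image (fun r => |(u ^ r) i|) := by
    ext b
    rw [hX, Finset.mem_image]
    constructor
    · rintro ⟨h1, r, h2, h3, h4⟩
      refine ⟨r, Finset.mem_Ioc.2 ⟨h2, h3⟩, ?_⟩
      have := abs_cases ((u ^ r) i)
      omega
    · rintro ⟨r, hr, rfl⟩
      rw [Finset.mem_Ioc] at hr
      have h1 := S_ne (pw_S Z.B Z.hi r)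
      have := abs_cases ((u ^ r) i)
      refine ⟨by omega, r, hr.1, hr.2, by omega⟩
  rw [this, Finset.card_image_of_injOn, Nat.card_Ioc]
  intro r hr s hs hrs
  simp only [Finset.coe_Ioc, Set.mem_Ioc] at hr hs
  simp only [abs_eq_abs] at hrs
  rcases lt_trichotomy r s with h1 | h1 | h1
  · have := Z.dist r s (by omega) h1 hs.2
    tauto
  · exact h1
  · have := Z.dist s r (by omega) h1 hr.2
    omega

noncomputable def R (n : ℕ) (u : Equiv.Perm ℤ) (i : ℤ) : ℚ :=
  ∏ b ∈ Finset.Icc 1 (n:ℤ) \ D n u i, term u b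

lemma D_sub (u : Equiv.Perm ℤ) (i : ℤ) : D n u i ⊆ Finset.Icc 1 (n:ℤ) := Finset.filter_subset _ _

lemma F_split (u w : Equiv.Perm ℤ) (i : ℤ) : F n w = psi n w (Zo n w).card *
    ((∏ b ∈ Finset.Icc 1 (n:ℤ) \ D n u i, term w b) * ∏ b ∈ D n u i, term w b) := by
  rw [F, Finset.prod_sdiff (D_sub u i)]

lemma R_away {x u : Equiv.Perm ℤ} {i : ℤ}
    (h : ∀ a, ¬ SC u i a → ¬ SC u i (-a) → (∀ b, SC x a b ↔ SC u a b) ∧ mp x a = mp u a) :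
    (∏ b ∈ Finset.Icc 1 (n:ℤ) \ D n u i, term x b) = R n u i := by
  apply Finset.prod_congr rfl
  intro b hb
  rw [Finset.mem_sdiff, mem_D, Finset.mem_Icc] at hb
  have h1 : ¬ SC u i b := fun h => hb.2 ⟨hb.1, Or.inl h⟩
  have h2 : ¬ SC u i (-b) := fun h => hb.2 ⟨hb.1, Or.inr h⟩
  obtain ⟨h3, h4⟩ := h b h1 h2
  exact term_away h3 h4

/-- value in the nonzero case -/
lemma FA {u : Equiv.Perm ℤ} (hu : inB n u) {i : ℤ} (hi : i ∈ signedSet n) (hz : ¬ Zr u i) :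
    F n u = psi n u (Zo n u).card * R n u i * aa (mp u i) := by
  rw [F_split u u i, prodD hu hi hz, R]; ring

lemma FA' {u : Equiv.Perm ℤ} (hn : 1 ≤ n) (hu : inB n u) {i : ℤ} (hi : i ∈ signedSet n) (hz : ¬ Zr u i) {m : ℕ}
    (hm : 1 ≤ m) (hmL : m < mp u i) :
    F n (u * rf i ((u ^ m) i)) = psi n u (Zo n u).card * R n u i * (aa m * aa (mp u i - m)) := by
  obtain ⟨hx, a1, a2, a3, a4, a5, a6, a7⟩ := caseA hu hi hz hm hmL
  have hng : ∀ r s, (u ^ r) i ≠ -(u ^ s) i := by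
    intro r s h
    apply hz
    have h1 := SC_pow (w := u) r i
    have h2 := SC_neg hu (SC_pow (w := u) s i)
    rw [← h] at h2
    exact h1.trans h2.symm
  have hin : ∀ r s, 1 ≤ r → r < s → s ≤ mp u i → (u ^ r) i ≠ (u ^ s) i := fun r s a b c => mp_inj a b c
  have hpL := mp_pow u i
  have hkS := pw_S hu hi m
  set k := (u ^ m) i with hk
  set x := u * rf i k with hxd
  have hxz : ¬ Zr x k := by
    intro h
    obtain ⟨r, _, _, h3⟩ := a3 _ h
    exact hng r m h3.symm
  have hxz' : ¬ Zr x i := by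
    intro h
    obtain ⟨r, _, _, h3⟩ := a6 _ h
    exact hng r 0 h3.symm
  have hxu : ∀ r, SC x k ((u ^ r) i) ∨ SC x i ((u ^ r) i) := by
    intro r
    obtain ⟨s, h1, h2, h3⟩ := SC_mp hu (SC_pow (w := u) r i)
    rw [← h3]
    by_cases hs : s ≤ m
    · exact Or.inl (a2 s h1 hs)
    · exact Or.inr (a5 s (by omega) h2)
  have hnz : ∀ b, SC u i b → ¬ Zr x b ∧ ¬ Zr u b := by
    intro b hb
    refine ⟨?_, fun h => hz (Zr_SC hu hb.symm h)⟩
    intro h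
    obtain ⟨r, rfl⟩ := SC_nat hu hb
    rcases hxu r with h1 | h1
    · exact hxz (Zr_SC hx h1.symm h)
    · exact hxz' (Zr_SC hx h1.symm h)
  have hZ : ∀ b, Zr x b ↔ Zr u b := by
    intro b
    by_cases h1 : SC u i b
    · have := hnz b h1; tauto
    by_cases h2 : SC u i (-b)
    · have := hnz _ h2
      constructor
      · intro h; exact absurd (Zr_neg h) this.1
      · intro h; exact absurd (Zr_neg h) this.2
    exact (a7 b h1 h2).1 _
  have hpsi : psi n x (Zo n x).card = psi n u (Zo n u).card := by
    simp only [psi, Zo, hZ]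
  have hD : D n u i = D n x k ∪ D n x i := by
    ext b
    simp only [Finset.mem_union, mem_D, ← and_or_left]
    apply and_congr_right
    intro hb
    constructor
    · rintro (h | h)
      · obtain ⟨r, rfl⟩ := SC_nat hu h
        have := hxu r; tauto
      · obtain ⟨r, h3⟩ := SC_nat hu h
        have := hxu r; rw [h3] at this; tauto
    · have k1 : ∀ c, SC x k c → SC u i c := by
        intro c hc
        obtain ⟨r, _, _, rfl⟩ := a3 _ hc
        exact SC_pow _ _
      have k2 : ∀ c, SC x i c → SC u i c := by
        intro c hc
        obtain ⟨r, _, _, rfl⟩ := a6 _ hc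
        exact SC_pow _ _
      rintro ((h | h) | (h | h))
      · exact Or.inl (k1 _ h)
      · exact Or.inr (k1 _ h)
      · exact Or.inl (k2 _ h)
      · exact Or.inr (k2 _ h)
  have hdis : Disjoint (D n x k) (D n x i) := by
    rw [Finset.disjoint_left]
    intro b hb hb'
    rw [mem_D] at hb hb'
    rcases hb.2 with h | h <;> rcases hb'.2 with h' | h' <;>
      obtain ⟨r, r1, r2, r3⟩ := a3 _ h <;> obtain ⟨s, s1, s2, s3⟩ := a6 _ h'
    · exact hin r s r1 (by omega) s2 (r3.symm.trans s3)
    · exact hng s r (by omega)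
    · exact hng r s (by omega)
    · exact hin r s r1 (by omega) s2 (r3.symm.trans s3)
  rw [F_split u x i, hpsi, R_away a7, hD, Finset.prod_union hdis, prodD hx hkS hxz, prodD hx hi hxz', a1, a4]
  ring

lemma mem_Zo {w : Equiv.Perm ℤ} {b : ℤ} : b ∈ Zo n w ↔ (1 ≤ b ∧ b ≤ n) ∧ b ≠ n ∧ Zr w b := by
  rw [Zo, Finset.mem_filter, Finset.mem_Icc]

lemma Nice.Zo_mem {u : Equiv.Perm ℤ} (N : Nice n u) {i : ℤ} {h : ℕ} (hi : Out n i) (Z : ZC n u i h) {b : ℤ}  :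
    b ∈ Zo n u ↔ 1 ≤ b ∧ ∃ r, 0 < r ∧ r ≤ h ∧ (b = (u ^ r) i ∨ b = -(u ^ r) i) := by
  rw [mem_Zo]
  constructor
  · rintro ⟨h1, h2, h3⟩
    refine ⟨h1.1, Z.ex (N.one i b hi ⟨Icc_S h1, h2, by omega⟩ Z.Zr h3)⟩
  · rintro ⟨h1, r, h2, h3, h4⟩
    have hs : SC u i b := by
      rcases h4 with rfl | rfl
      · exact SC_pow _ _
      · exact Z.Zr.trans (SC_neg N.B (SC_pow _ _))
    have hbS := SC_mem N.B hs hi.1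
    rw [mem_S] at hbS
    exact ⟨by omega, (N.zout hi Z.Zr hs).1, Zr_SC N.B hs Z.Zr⟩

lemma FB {u : Equiv.Perm ℤ} (N : Nice n u) {i : ℤ} {h : ℕ} (hi : Out n i) (Z : ZC n u i h) :
    F n u = psi n u h * R n u i := by
  rw [F_split u u i, card_orb Z (fun b => N.Zo_mem hi Z), Nat.sub_zero, ← R]
  rw [Finset.prod_eq_one, mul_one]
  intro b hb
  rw [mem_D] at hb
  rw [term, if_pos]
  rcases hb.2 with h | h
  · exact Zr_SC N.B h Z.Zr
  · have := Zr_neg (Zr_SC N.B h Z.Zr)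
    rwa [neg_neg] at this

lemma FB' {u : Equiv.Perm ℤ} (N : Nice n u) {i : ℤ} {h m : ℕ} (hi : Out n i) (Z : ZC n u i h)
    (hm : 1 ≤ m) (hmh : m ≤ h) :
    F n (u * rf i ((u ^ m) i)) = psi n u (h-m) * aa m * R n u i := by
  obtain ⟨hx, b1, b2, b3, b4, b5, b6⟩ := caseB Z hm hmh
  have hkS := pw_S N.B hi.1 m
  have hzz : ∀ a, Zr (u * rf i ((u ^ m) i)) a → a ∈ signedSet n → Zr u a := by
    intro a ha haS
    refine Mv_Zr N.B haS (rk_le_of_mem hi.1 hkS (Z.ne' hm hmh).symm ?_ (Zr_Mv hx ha))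
    exact SC_Mv N.B (SC_pow _ _)
  set k := (u ^ m) i with hk
  set x := u * rf i k with hxd
  have hzr : ∀ r, m < r → r ≤ h → Zr x ((u ^ r) i) := by
    intro r h1 h2
    have h3 := b5 h (by omega) le_rfl
    rw [Z.hh] at h3
    exact Zr_SC hx (b5 r h1 h2) h3
  have hnr : ∀ r, 1 ≤ r → r ≤ m → ¬ Zr x ((u ^ r) i) := by
    intro r h1 h2 h3
    exact b4 (Zr_SC hx (b2 r h1 h2).symm h3)
  have hn1 : ¬ SC u i n := fun h => (N.zout hi Z.Zr h).1 rfl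
  have hpsi : psi n x = psi n u := by
    funext j
    simp only [psi, Zr, (b6 n hn1).1]
  have hZo : ∀ b, b ∈ Zo n x ↔ 1 ≤ b ∧ ∃ r, m < r ∧ r ≤ h ∧ (b = (u ^ r) i ∨ b = -(u ^ r) i) := by
    intro b
    rw [mem_Zo]
    constructor
    · rintro ⟨h1, h2, h3⟩
      refine ⟨h1.1, ?_⟩
      have h4 := hzz b h3 (Icc_S h1)
      obtain ⟨r, r1, r2, r3⟩ := Z.ex (N.one i b hi ⟨Icc_S h1, h2, by omega⟩ Z.Zr h4)
      refine ⟨r, ?_, r2, r3⟩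
      by_contra hlt
      apply hnr r r1 (by omega)
      rcases r3 with r3 | r3
      · rw [← r3]; exact h3
      · have := Zr_neg h3
        rwa [r3, neg_neg] at this
    · rintro ⟨h1, r, r1, r2, r3⟩
      have := (N.Zo_mem hi Z (b := b)).2 ⟨h1, r, by omega, r2, r3⟩
      rw [mem_Zo] at this
      refine ⟨this.1, this.2.1, ?_⟩
      rcases r3 with r3 | r3
      · rw [r3]; exact hzr r r1 r2
      · rw [r3]; exact Zr_neg (hzr r r1 r2)
  have hsub : D n x k ⊆ D n u i := by
    intro b hb
    rw [mem_D] at hb ⊢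
    refine ⟨hb.1, ?_⟩
    rcases hb.2 with h | h
    · obtain ⟨r, _, _, h3⟩ := b3 _ h
      left; rw [h3]; exact SC_pow _ _
    · obtain ⟨r, _, _, h3⟩ := b3 _ h
      right; rw [h3]; exact SC_pow _ _
  have hD : ∏ b ∈ D n u i, term x b = aa m := by
    rw [← Finset.prod_sdiff hsub, prodD hx hkS b4, b1, Finset.prod_eq_one, one_mul]
    intro b hb
    rw [Finset.mem_sdiff, mem_D, mem_D] at hb
    rw [term, if_pos]
    have hs : SC u i b := by
      rcases hb.1.2 with h | h
      · exact h
      · have := SC_neg N.B h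
        rw [neg_neg] at this
        exact Z.Zr.trans this
    obtain ⟨r, r1, r2, r3⟩ := Z.ex hs
    by_cases hr : r ≤ m
    · exfalso
      apply hb.2
      refine ⟨hb.1.1, ?_⟩
      have := b2 r r1 hr
      rcases r3 with r3 | r3
      · rw [← r3] at this; exact Or.inl this
      · right; rw [r3, neg_neg]; exact this
    · have := hzr r (by omega) r2
      rcases r3 with r3 | r3
      · rw [r3]; exact this
      · rw [r3]; exact Zr_neg this
  rw [F_split u x i, hD, R_away (fun a h1 _ => b6 a h1), card_orb Z hZo, hpsi]
  ring

lemma FC {u : Equiv.Perm ℤ} (N : Nice n u) {i k : ℤ} {h : ℕ} (hi : Out n i) (Z : ZC n u i h)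
    (hnz : Zr u n) (hkn : k = n ∨ k = -n) :
    F n (u * rf i k) = aa (h+1) * R n u i := by
  obtain ⟨hkS, c2, c3⟩ := N.oneC hi Z hnz hkn
  obtain ⟨hx, d1, d2, d3, d4, d5⟩ := caseC Z hkS c2 c3
  have c30 := c3 0
  simp only [pow_zero, Equiv.Perm.one_apply] at c30
  have hzz : ∀ a, Zr (u * rf i k) a → a ∈ signedSet n → Zr u a := by
    intro a ha haS
    refine Mv_Zr N.B haS (rk_le_of_mem hi.1 hkS c30.1 ?_ (Zr_Mv hx ha))
    apply sub_mem (Zr_Mv N.B Z.Zr) (Zr_Mv N.B _)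
    rcases hkn with rfl | rfl
    · exact hnz
    · exact Zr_neg hnz
  set x := u * rf i k with hxd
  have hnD : (n:ℤ) ∉ D n u i := by
    rw [mem_D]
    rintro ⟨_, h | h⟩
    · exact (N.zout hi Z.Zr h).1 rfl
    · exact (N.zout hi Z.Zr h).2 rfl
  have hninS := n_S N.pos
  have hnDx : (n:ℤ) ∈ D n x i := by
    rw [mem_D]
    have := N.pos
    refine ⟨by omega, ?_⟩
    rcases hkn with rfl | rfl
    · exact Or.inr d2
    · left; rw [neg_neg] at d2; exact d2
  have hux : ∀ b, SC u i b → SC x i b ∨ SC x i (-b) := by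
    intro b hb
    obtain ⟨r, r1, r2, r3⟩ := Z.ex hb
    have := d3 r r1 r2
    rcases r3 with rfl | rfl
    · exact Or.inr this
    · exact Or.inl this
  have hnzx : ∀ b, SC x i b ∨ SC x i (-b) → ¬ Zr x b := by
    rintro b (h | h) hb
    · exact d4 (Zr_SC hx h.symm hb)
    · exact d4 (Zr_SC hx h.symm (Zr_neg hb))
  have hDx : D n x i = insert (n:ℤ) (D n u i) := by
    apply le_antisymm
    · intro b hb
      rw [Finset.mem_insert]
      by_contra hcon
      push Not at hcon
      rw [mem_D] at hb hcon
      have h1 : ¬ SC u i b := fun h => hcon.2 ⟨hb.1, Or.inl h⟩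
      have h2 : ¬ SC u i (-b) := fun h => hcon.2 ⟨hb.1, Or.inr h⟩
      have hbk : b ≠ k ∧ b ≠ -k := by rcases hkn with rfl | rfl <;> omega
      have := (d5 b h1 hbk.1 hbk.2).1
      rcases hb.2 with h | h
      · exact h1 (((this i).1 h.symm).symm)
      · have h3 := SC_neg hx h.symm
        rw [neg_neg] at h3
        have h4 := SC_neg N.B ((this (-i)).1 h3)
        rw [neg_neg] at h4
        exact h2 h4.symm
    · intro b hb
      rw [Finset.mem_insert] at hb
      rcases hb with rfl | hb
      · exact hnDx
      · rw [mem_D] at hb ⊢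
        refine ⟨hb.1, ?_⟩
        rcases hb.2 with h | h
        · exact hux b h
        · have := hux _ h
          rw [neg_neg] at this
          exact this.symm
  have hZo : Zo n x = ∅ := by
    rw [Finset.eq_empty_iff_forall_notMem]
    intro b hb
    rw [mem_Zo] at hb
    have hbu := hzz b hb.2.2 (Icc_S hb.1)
    exact hnzx b (hux b (N.one i b hi ⟨Icc_S hb.1, hb.2.1, by omega⟩ Z.Zr hbu)) hb.2.2
  have hpsi : psi n x 0 = 1 := by
    rw [psi, if_neg, mm, if_pos rfl]
    exact hnzx n (mem_D.1 hnDx).2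
  have hR : R n u i = ∏ b ∈ Finset.Icc 1 (n:ℤ) \ D n x i, term x b := by
    rw [R]
    have hsub : Finset.Icc 1 (n:ℤ) \ D n x i ⊆ Finset.Icc 1 (n:ℤ) \ D n u i := by
      apply Finset.sdiff_subset_sdiff le_rfl
      rw [hDx]; exact Finset.subset_insert _ _
    rw [← Finset.prod_subset hsub (f := term u)]
    · apply Finset.prod_congr rfl
      intro b hb
      rw [Finset.mem_sdiff, hDx, Finset.mem_insert, mem_D, Finset.mem_Icc] at hb
      push Not at hb
      have hbk : b ≠ k ∧ b ≠ -k := by have := hb.2.1; rcases hkn with rfl | rfl <;> omega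
      have := d5 b (hb.2.2 hb.1).1 hbk.1 hbk.2
      exact (term_away this.1 this.2).symm
    · intro b hb hb'
      have : b = n := by
        rw [Finset.mem_sdiff] at hb hb'
        by_contra hbn
        apply hb'
        refine ⟨hb.1, ?_⟩
        rw [hDx, Finset.mem_insert]
        tauto
      rw [this, term, if_pos hnz]
  rw [F_split x x i, prodD hx hi.1 d4, d1, hZo, Finset.card_empty, hpsi, ← hR]
  ring

end NB

namespace NB
variable {n : ℕ}

lemma cat_sum (N : ℕ) : ∑ j ∈ Finset.range (N+1), (catalan j : ℚ) * catalan (N - j) = catalan (N+1) := by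
  rw [catalan_succ', Finset.Nat.sum_antidiagonal_eq_sum_range_succ_mk]
  push_cast
  rfl

lemma cb_cat (j : ℕ) : (Nat.centralBinom j : ℚ) = (j+1) * catalan j := by
  rw [← succ_mul_catalan_eq_centralBinom]; push_cast; ring

lemma cb_sum (N : ℕ) : ∑ j ∈ Finset.range (N+1), (catalan j : ℚ) * Nat.centralBinom (N - j) =
    Nat.centralBinom (N+1) / 2 := by
  have h1 : ∑ j ∈ Finset.range (N+1), (catalan j : ℚ) * Nat.centralBinom (N - j) =
      ∑ j ∈ Finset.range (N+1), (catalan (N - j) : ℚ) * Nat.centralBinom j := by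
    rw [← Finset.sum_range_reflect]
    apply Finset.sum_congr rfl
    intro j hj
    rw [Finset.mem_range] at hj
    have a1 : N + 1 - 1 - j = N - j := by omega
    have a2 : N - (N - j) = j := by omega
    rw [a1, a2]
  have h2 : ∑ j ∈ Finset.range (N+1), (catalan j : ℚ) * Nat.centralBinom (N - j) +
      ∑ j ∈ Finset.range (N+1), (catalan (N - j) : ℚ) * Nat.centralBinom j =
      (N + 2) * catalan (N+1) := by
    rw [← cat_sum, Finset.mul_sum, ← Finset.sum_add_distrib]
    apply Finset.sum_congr rfl
    intro j hj
    rw [Finset.mem_range] at hj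
    rw [cb_cat, cb_cat, Nat.cast_sub (by omega)]
    ring
  rw [← h1] at h2
  have := cb_cat (N+1)
  push_cast at this
  linarith

lemma aa_s (j : ℕ) : aa (j+1) = (-1)^j * catalan j := by simp [aa]

lemma sgn {N j : ℕ} (h : j ≤ N) : (-1:ℚ)^j * (-1)^(N-j) = (-1)^N := by
  rw [← pow_add]; congr 1; omega

lemma idI (L : ℕ) : aa (L+2) + ∑ m ∈ Finset.range (L+1), aa (m+1) * aa (L+1-m) = 0 := by
  have : ∑ m ∈ Finset.range (L+1), aa (m+1) * aa (L+1-m) = (-1)^L * catalan (L+1) := by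
    rw [← cat_sum, Finset.mul_sum]
    apply Finset.sum_congr rfl
    intro j hj
    rw [Finset.mem_range] at hj
    have a1 : L + 1 - j = (L - j) + 1 := by omega
    rw [a1, aa_s, aa_s, ← sgn (show j ≤ L by omega)]; ring
  rw [this, aa_s]; ring

lemma idII (N : ℕ) : mm (N+1) + aa (N+1) * mm 0 + 2 * ∑ j ∈ Finset.range N, aa (j+1) * mm (N-j) = 0 := by
  have : 2 * ∑ m ∈ Finset.range N, aa (m+1) * mm (N-m) =
      (-1)^N * ∑ m ∈ Finset.range N, (catalan m : ℚ) * Nat.centralBinom (N - m) := by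
    rw [Finset.mul_sum, Finset.mul_sum]
    apply Finset.sum_congr rfl
    intro j hj
    rw [Finset.mem_range] at hj
    rw [aa_s, mm, if_neg (by omega), ← sgn (show j ≤ N by omega)]; ring
  have h2 := cb_sum N
  rw [Finset.sum_range_succ] at h2
  simp only [Nat.sub_self, Nat.centralBinom_zero, Nat.cast_one, mul_one] at h2
  rw [this, eq_sub_of_add_eq h2, aa_s, mm, mm, if_neg (by omega), if_pos rfl]
  ring

lemma idIII (N : ℕ) : gg (N+1) + aa (N+1) * gg 0 + 2 * ∑ j ∈ Finset.range N, aa (j+1) * gg (N-j)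
    + 2 * aa (N+2) = 0 := by
  have : 2 * ∑ m ∈ Finset.range N, aa (m+1) * gg (N-m) =
      (-1)^N * (-5 * ∑ m ∈ Finset.range N, (catalan m : ℚ) * Nat.centralBinom (N - m)
        + 4 * ∑ m ∈ Finset.range N, (catalan m : ℚ) * catalan (N - m)) := by
    rw [Finset.mul_sum, Finset.mul_sum, Finset.mul_sum, ← Finset.sum_add_distrib, Finset.mul_sum]
    apply Finset.sum_congr rfl
    intro j hj
    rw [Finset.mem_range] at hj
    rw [aa_s, gg, if_neg (by omega), ← sgn (show j ≤ N by omega)]; ring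
  have h2 := cb_sum N
  rw [Finset.sum_range_succ] at h2
  simp only [Nat.sub_self, Nat.centralBinom_zero, Nat.cast_one, mul_one] at h2
  have h3 := cat_sum N
  rw [Finset.sum_range_succ] at h3
  simp only [Nat.sub_self, catalan_zero, Nat.cast_one, mul_one] at h3
  rw [this, eq_sub_of_add_eq h2, eq_sub_of_add_eq h3, aa_s, aa_s, gg, gg, if_neg (by omega), if_pos rfl]
  ring

lemma gg_final (p : ℕ) (hp : 1 ≤ p) : gg p = (-1 : ℚ) ^ (p+1) * (Nat.choose (2 * (p+1) - 1) (p+1) : ℚ) *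
        ((5 * ((p+1 : ℕ) : ℚ) - 4) / (4 * ((p+1:ℕ) : ℚ) - 2)) := by
  have h1 : ((2 * p + 1).choose (p+1) : ℚ) * (p+1) = (2*p+1) * Nat.centralBinom p := by
    have := Nat.add_one_mul_choose_eq (2*p) p
    rw [Nat.centralBinom]
    exact_mod_cast this.symm
  have h2 := cb_cat p
  have h3 : 2 * (p+1) - 1 = 2 * p + 1 := by omega
  have hp1 : (p:ℚ) + 1 ≠ 0 := by positivity
  have hp2 : 2 * (p:ℚ) + 1 ≠ 0 := by positivity
  have hc : ((2 * p + 1).choose (p+1) : ℚ) = (2*p+1) * catalan p := by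
    rw [h2] at h1
    have : (((2 * p + 1).choose (p+1) : ℚ) - (2*p+1) * catalan p) * (p+1) = 0 := by linear_combination h1
    rcases mul_eq_zero.1 this with h | h
    · linarith
    · exact absurd h hp1
  rw [h3, hc, gg, if_neg (by omega), h2]
  push_cast
  have : 4 * ((p:ℚ)+1) - 2 = 2 * (2 * p + 1) := by ring
  rw [this]
  field_simp
  ring

end NB

namespace NB
variable {n : ℕ}
open Classical

noncomputable def K (n : ℕ) (u : Equiv.Perm ℤ) (i : ℤ) : Finset ℤ :=
  (Finset.Icc (-(n:ℤ)) n).filter (fun k => k ∈ signedSet n ∧ i ≠ k ∧ e n i - e n k ∈ Mv n u)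

lemma mem_K {u : Equiv.Perm ℤ} {i k : ℤ} : k ∈ K n u i ↔ k ∈ signedSet n ∧ i ≠ k ∧ e n i - e n k ∈ Mv n u := by
  rw [K, Finset.mem_filter, Finset.mem_Icc]
  constructor
  · exact fun h => h.2
  · intro h
    have := (mem_S.1 h.1)
    exact ⟨⟨this.2.1, this.2.2⟩, h⟩

lemma R_congr {u : Equiv.Perm ℤ} {i k : ℤ} (h : SC u i k) : R n u i = R n u k := by
  have : D n u i = D n u k := by
    ext b
    rw [mem_D, mem_D]
    have h1 : ∀ c, SC u i c ↔ SC u k c := fun c => ⟨fun h' => h.symm.trans h', fun h' => h.trans h'⟩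
    rw [h1, h1]
  rw [R, R, this]

lemma localA {u : Equiv.Perm ℤ} (N : Nice n u) {i : ℤ} (hi : Out n i) (hui : u i ≠ i) (hz : ¬ Zr u i) :
    F n u + ∑ k ∈ K n u i, F n (u * rf i k) = 0 := by
  have hL : 2 ≤ mp u i := by
    have h0 := mp_pos N.B i
    by_contra hlt
    have h1 : mp u i = 1 := by omega
    have := mp_pow u i
    rw [h1, pow_one] at this
    exact hui this
  have hK : K n u i = (Finset.Ico 1 (mp u i)).image (fun m => (u ^ m) i) := by
    ext k
    rw [mem_K, Finset.mem_image]
    constructor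
    · rintro ⟨h1, h2, h3⟩
      rcases (Mv_iff N.B hi.1 h1).1 h3 with h | h
      · obtain ⟨r, hr1, hr2, hr3⟩ := SC_mp N.B h
        refine ⟨r, ?_, hr3⟩
        rw [Finset.mem_Ico]
        refine ⟨hr1, lt_of_le_of_ne hr2 ?_⟩
        rintro rfl
        rw [mp_pow] at hr3
        exact h2 hr3
      · exact absurd h.1 hz
    · rintro ⟨m, hm, rfl⟩
      rw [Finset.mem_Ico] at hm
      refine ⟨pw_S N.B hi.1 m, ?_, ?_⟩
      · have := mp_inj (w := u) (a := i) hm.1 hm.2 le_rfl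
        rw [mp_pow] at this
        exact this.symm
      · exact (Mv_iff N.B hi.1 (pw_S N.B hi.1 m)).2 (Or.inl (SC_pow m i))
  rw [hK, Finset.sum_image]
  · have : ∀ m ∈ Finset.Ico 1 (mp u i), F n (u * rf i ((u ^ m) i)) =
        psi n u (Zo n u).card * R n u i * (aa m * aa (mp u i - m)) := by
      intro m hm
      rw [Finset.mem_Ico] at hm
      exact FA' N.pos N.B hi.1 hz hm.1 hm.2
    rw [Finset.sum_congr rfl this, ← Finset.mul_sum, FA N.B hi.1 hz, ← mul_add,
      Finset.sum_Ico_eq_sum_range]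
    obtain ⟨L, hL'⟩ := Nat.exists_eq_add_of_le hL
    have h2 : mp u i = L + 2 := by omega
    rw [h2]
    have h3 := idI L
    have h4 : ∑ k ∈ Finset.range (L + 2 - 1), aa (1 + k) * aa (L + 2 - (1 + k)) =
        ∑ m ∈ Finset.range (L+1), aa (m+1) * aa (L+1-m) := by
      apply Finset.sum_congr rfl
      intro m _
      congr 2 <;> omega
    rw [h4, h3, mul_zero]
  · intro a ha b hb hab
    simp only [Finset.coe_Ico, Set.mem_Ico] at ha hb
    rcases lt_trichotomy a b with h | h | h
    · exact absurd hab (mp_inj ha.1 h hb.2.le)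
    · exact h
    · exact absurd hab.symm (mp_inj hb.1 h ha.2.le)

lemma localB {u : Equiv.Perm ℤ} (N : Nice n u) {i : ℤ} (hi : Out n i) {h : ℕ} (Z : ZC n u i h) :
    F n u + ∑ k ∈ K n u i, F n (u * rf i k) = 0 := by
  have hz := Z.Zr
  have hS := fun r => pw_S N.B hi.1 r
  have h0 := fun r => S_ne (hS r)
  set A := (Finset.Ico 1 (h+1)).image (fun m => (u ^ m) i) with hA
  set B := (Finset.Ico 1 h).image (fun m => -(u ^ m) i) with hB
  set C : Finset ℤ := if Zr u n then {(n:ℤ), -(n:ℤ)} else ∅ with hC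
  have hK : K n u i = (A ∪ B) ∪ C := by
    ext k
    rw [mem_K, Finset.mem_union, Finset.mem_union, hA, hB, Finset.mem_image, Finset.mem_image]
    constructor
    · rintro ⟨h1, h2, h3⟩
      have hkz : Zr u k := by
        rcases (Mv_iff N.B hi.1 h1).1 h3 with h' | h'
        · exact Zr_SC N.B h' hz
        · exact h'.2
      by_cases hko : Out n k
      · left
        obtain ⟨r, hr1, hr2, hr3⟩ := Z.ex (N.one i k hi hko hz hkz)
        rcases hr3 with hr3 | hr3
        · left; exact ⟨r, by rw [Finset.mem_Ico]; omega, hr3.symm⟩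
        · right
          refine ⟨r, ?_, hr3.symm⟩
          rw [Finset.mem_Ico]
          refine ⟨hr1, lt_of_le_of_ne hr2 ?_⟩
          rintro rfl
          rw [Z.hh, neg_neg] at hr3
          exact h2 hr3.symm
      · right
        have hkn : k = n ∨ k = -n := by
          unfold Out at hko; tauto
        have : Zr u n := by
          rcases hkn with rfl | rfl
          · exact hkz
          · have := Zr_neg hkz; rwa [neg_neg] at this
        rw [hC, if_pos this]
        simpa using hkn
    · intro hk
      have aux : k ∈ signedSet n ∧ i ≠ k ∧ Zr u k := by
        rcases hk with (⟨m, hm, rfl⟩ | ⟨m, hm, rfl⟩) | hk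
        · rw [Finset.mem_Ico] at hm
          exact ⟨hS m, (Z.ne' hm.1 (by omega)).symm, Zr_SC N.B (SC_pow m i) hz⟩
        · rw [Finset.mem_Ico] at hm
          refine ⟨neg_S.2 (hS m), ?_, Zr_neg (Zr_SC N.B (SC_pow m i) hz)⟩
          intro h'
          apply (Z.ne hm.1 hm.2).2
          omega
        · by_cases hzn : Zr u n
          · rw [hC, if_pos hzn] at hk
            simp only [Finset.mem_insert, Finset.mem_singleton] at hk
            rcases hk with rfl | rfl
            · exact ⟨n_S N.pos, hi.2.1, hzn⟩
            · exact ⟨neg_S.2 (n_S N.pos), hi.2.2, Zr_neg hzn⟩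
          · rw [hC, if_neg hzn] at hk
            simp at hk
      exact ⟨aux.1, aux.2.1, (Mv_iff N.B hi.1 aux.1).2 (Or.inr ⟨hz, aux.2.2⟩)⟩
  have hAB : Disjoint A B := by
    rw [Finset.disjoint_left]
    intro k h1 h2
    rw [hA, Finset.mem_image] at h1
    rw [hB, Finset.mem_image] at h2
    obtain ⟨r, hr, rfl⟩ := h1
    obtain ⟨s, hs, hrs⟩ := h2
    rw [Finset.mem_Ico] at hr hs
    rcases lt_trichotomy r s with h' | h' | h'
    · exact (Z.dist r s hr.1 h' (by omega)).2 hrs.symm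
    · subst h'
      have := h0 r
      omega
    · apply (Z.dist s r hs.1 h' (by omega)).2
      omega
  have hABC : Disjoint (A ∪ B) C := by
    rw [Finset.disjoint_left]
    intro k h1 h2
    have : SC u i k := by
      rw [Finset.mem_union, hA, hB, Finset.mem_image, Finset.mem_image] at h1
      rcases h1 with ⟨m, hm, rfl⟩ | ⟨m, hm, rfl⟩
      · exact SC_pow m i
      · exact Equiv.Perm.SameCycle.trans hz (SC_neg N.B (SC_pow m i))
    have h3 := N.zout hi hz this
    by_cases hzn : Zr u n
    · rw [hC, if_pos hzn] at h2
      simp only [Finset.mem_insert, Finset.mem_singleton] at h2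
      tauto
    · rw [hC, if_neg hzn] at h2
      simp at h2
  have inj : ∀ a b, 1 ≤ a → a ≤ h → 1 ≤ b → b ≤ h → (u ^ a) i = (u ^ b) i → a = b := by
    intro a b h1 h2 h3 h4 h5
    rcases lt_trichotomy a b with h' | h' | h'
    · exact absurd h5 (Z.dist a b h1 h' h4).1
    · exact h'
    · exact absurd h5.symm (Z.dist b a h3 h' h2).1
  have sA : ∑ k ∈ A, F n (u * rf i k) = ∑ m ∈ Finset.Ico 1 (h+1), psi n u (h-m) * aa m * R n u i := by
    rw [hA, Finset.sum_image]
    · apply Finset.sum_congr rfl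
      intro m hm
      rw [Finset.mem_Ico] at hm
      exact FB' N hi Z hm.1 (by omega)
    · intro a ha b hb hab
      simp only [Finset.coe_Ico, Set.mem_Ico] at ha hb
      exact inj a b ha.1 (by omega) hb.1 (by omega) hab
  have sB : ∑ k ∈ B, F n (u * rf i k) = ∑ m ∈ Finset.Ico 1 h, psi n u (h - (h-m)) * aa (h-m) * R n u i := by
    rw [hB, Finset.sum_image]
    · apply Finset.sum_congr rfl
      intro m hm
      rw [Finset.mem_Ico] at hm
      have hsc : SC u i (-(u ^ m) i) := Equiv.Perm.SameCycle.trans hz (SC_neg N.B (SC_pow m i))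
      have hout : Out n (-(u ^ m) i) := ⟨neg_S.2 (hS m), N.zout hi hz hsc⟩
      have hZ : ZC n u (-(u ^ m) i) h := (Z.pw m).neg
      have hik : (u ^ (h - m)) (-(u ^ m) i) = i := by
        rw [pw_neg N.B, ← pw_add, Nat.sub_add_cancel hm.2.le, Z.hh, neg_neg]
      have := FB' N hout hZ (m := h - m) (by omega) (by omega)
      have hne : -(u ^ m) i ≠ i := by
        intro h'
        apply (Z.ne hm.1 hm.2).2
        omega
      rw [hik, rf_comm (S_ne hout.1) (S_ne hi.1) hne, ← R_congr hsc] at this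
      exact this
    · intro a ha b hb hab
      simp only [Finset.coe_Ico, Set.mem_Ico] at ha hb
      exact inj a b ha.1 (by omega) hb.1 (by omega) (by simpa using hab)
  rw [hK, Finset.sum_union hABC, Finset.sum_union hAB, sA, sB, FB N hi Z]
  obtain ⟨M, rfl⟩ : ∃ M, h = M + 1 := ⟨h - 1, by have := Z.h1; omega⟩
  have e1 : ∑ m ∈ Finset.Ico 1 (M+1+1), psi n u (M+1-m) * aa m * R n u i =
      (∑ j ∈ Finset.range M, aa (j+1) * psi n u (M-j) + aa (M+1) * psi n u 0) * R n u i := by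
    rw [Finset.sum_Ico_eq_sum_range, ← Finset.sum_mul]
    congr 1
    rw [show M + 1 + 1 - 1 = M + 1 by omega, Finset.sum_range_succ]
    congr 1
    · apply Finset.sum_congr rfl
      intro j _
      rw [show M + 1 - (1 + j) = M - j by omega, add_comm 1 j]; ring
    · rw [show M + 1 - (1 + M) = 0 by omega, add_comm 1 M]; ring
  have e2 : ∑ m ∈ Finset.Ico 1 (M+1), psi n u (M+1-(M+1-m)) * aa (M+1-m) * R n u i =
      (∑ j ∈ Finset.range M, aa (j+1) * psi n u (M-j)) * R n u i := by
    rw [Finset.sum_Ico_eq_sum_range, ← Finset.sum_mul]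
    congr 1
    rw [show M + 1 - 1 = M by omega, ← Finset.sum_range_reflect]
    apply Finset.sum_congr rfl
    intro j hj
    rw [Finset.mem_range] at hj
    rw [show M + 1 - (M + 1 - (1 + (M - 1 - j))) = M - j by omega,
      show M + 1 - (1 + (M - 1 - j)) = j + 1 by omega]; ring
  rw [e1, e2]
  by_cases hzn : Zr u n
  · have sC : ∑ k ∈ C, F n (u * rf i k) = 2 * (aa (M+1+1) * R n u i) := by
      rw [hC, if_pos hzn, Finset.sum_pair, FC N hi Z hzn (Or.inl rfl), FC N hi Z hzn (Or.inr rfl)]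
      · ring
      · have := N.pos; omega
    rw [sC]
    have hp : ∀ j, psi n u j = gg j := fun j => by rw [psi, if_pos hzn]
    simp only [hp]
    have := idIII M
    linear_combination (R n u i) * this
  · rw [hC, if_neg hzn, Finset.sum_empty]
    have hp : ∀ j, psi n u j = mm j := fun j => by rw [psi, if_neg hzn]
    simp only [hp]
    have := idII M
    linear_combination (R n u i) * this

lemma local_id {u : Equiv.Perm ℤ} (N : Nice n u) {i : ℤ} (hi : Out n i) (hui : u i ≠ i) :
    F n u + ∑ k ∈ K n u i, F n (u * rf i k) = 0 := by
  by_cases hz : Zr u i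
  · obtain ⟨h, Z⟩ := ZC_ex N.B hi.1 hz
    exact localB N hi Z
  · exact localA N hi hui hz

lemma F_one (hn : 1 ≤ n) : F n 1 = 1 := by
  have hsc : ∀ a b, SC (1 : Equiv.Perm ℤ) a b ↔ a = b := by
    intro a b; exact Equiv.Perm.sameCycle_one
  have hz : ∀ b : ℤ, b ≠ 0 → ¬ Zr 1 b := by
    intro b hb h
    have := (hsc _ _).1 h
    omega
  have hZo : Zo n 1 = ∅ := by
    apply Finset.eq_empty_of_forall_notMem
    intro b hb
    have hb2 := mem_Zo.1 hb
    exact hz b (by omega) hb2.2.2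
  rw [F, hZo, psi, if_neg (hz n (by omega)), Finset.card_empty, mm, if_pos rfl, one_mul]
  apply Finset.prod_eq_one
  intro b hb
  rw [Finset.mem_Icc] at hb
  rw [term, if_neg (hz b (by omega))]
  split_ifs
  · have : mp 1 b = 1 := mp_eq one_pos (by simp) (by intro r h1 h2; omega)
    rw [this]; simp [aa]
  · rfl

lemma local_n {u : Equiv.Perm ℤ} (hn : 1 ≤ n) (hu : inB n u) (hun : u n = -n) (hfix : ∀ i, Out n i → u i = i) :
    F n u + ∑ k ∈ K n u n, F n (u * rf n k) = 0 := by
  have hnS := n_S hn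
  have hzn : Zr u n := by
    have := SC_pow (w := u) 1 n
    rwa [pow_one, hun] at this
  have hsc : ∀ i, Out n i → ∀ b, SC u i b → b = i := by
    intro i hi b hb
    obtain ⟨r, rfl⟩ := SC_nat hu hb
    clear hb
    induction r with
    | zero => rfl
    | succ r ih => rw [pw_succ, ih, hfix i hi]
  have hzo : ∀ i, Out n i → ¬ Zr u i := by
    intro i hi h
    have := hsc i hi _ h
    have := S_ne hi.1
    omega
  have hK : K n u n = {-(n:ℤ)} := by
    ext k
    rw [mem_K, Finset.mem_singleton]
    constructor
    · rintro ⟨h1, h2, h3⟩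
      have hkz : Zr u k := by
        rcases (Mv_iff hu hnS h1).1 h3 with h' | h'
        · exact Zr_SC hu h' hzn
        · exact h'.2
      by_contra hne
      exact hzo k ⟨h1, fun h => h2 h.symm, hne⟩ hkz
    · rintro rfl
      refine ⟨neg_S.2 hnS, by omega, (Mv_iff hu hnS (neg_S.2 hnS)).2 (Or.inl hzn)⟩
  have h1 : u * rf n (-(n:ℤ)) = 1 := by
    ext b
    rw [Equiv.Perm.mul_apply, Equiv.Perm.one_apply]
    by_cases hb1 : b = n
    · rw [hb1, rf_left (by omega) (by omega), hu.1, hun, neg_neg]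
    by_cases hb2 : b = -n
    · rw [hb2, rf_right (by omega) (by omega), hun]
    · rw [rf_of_ne (by assumption) (by assumption) (by assumption) (by rwa [neg_neg])]
      by_cases hb : b ∈ signedSet n
      · exact hfix b ⟨hb, hb1, hb2⟩
      · exact hu.2 b hb
  rw [hK, Finset.sum_singleton, h1, F_one hn]
  have hZo : Zo n u = ∅ := by
    rw [Zo, Finset.filter_eq_empty_iff]
    intro b hb h
    rw [Finset.mem_Icc] at hb
    exact hzo b ⟨Icc_S hb, h.1, by omega⟩ h.2
  rw [F, hZo, psi, if_pos hzn, Finset.card_empty, gg, if_pos rfl, Finset.prod_eq_one]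
  · norm_num
  · intro b hb
    rw [Finset.mem_Icc] at hb
    rw [term]
    split_ifs with h1 h2
    · rfl
    · have hbo : Out n b := ⟨Icc_S hb, by rintro rfl; exact h1 hzn, by omega⟩
      have : mp u b = 1 := mp_eq one_pos (by rw [pow_one]; exact hfix b hbo) (by intro r h1 h2; omega)
      rw [this]; simp [aa]
    · rfl

end NB

namespace NB
variable {n : ℕ}
open Classical

lemma T_fin (g : Equiv.Perm ℤ) : (T n g).Finite := B_fin.subset (fun _ h => h.1)

noncomputable def TF (n : ℕ) (g : Equiv.Perm ℤ) : Finset (Equiv.Perm ℤ) := (T_fin (n := n) g).toFinset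

lemma mem_TF {g x : Equiv.Perm ℤ} : x ∈ TF n g ↔ x ∈ T n g := by rw [TF, Set.Finite.mem_toFinset]

lemma regroup {g y : Equiv.Perm ℤ} (hg : inB n g) (hgt : Mv n g = ⊤) (hy : y ∈ T n g) {i : ℤ}
    (hi : i ∈ signedSet n) (G : Equiv.Perm ℤ → ℚ)
    (hloc : ∀ u ∈ T n g, le n u y → u i = y i → G u + ∑ k ∈ K n u i, G (u * rf i k) = 0) :
    ∑ x ∈ (TF n g).filter (fun x => Mv n x ≤ Mv n y), G x = 0 := by
  set X := (TF n g).filter (fun x => Mv n x ≤ Mv n y) with hX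
  have mX : ∀ x, x ∈ X ↔ x ∈ T n g ∧ Mv n x ≤ Mv n y := by
    intro x; rw [hX, Finset.mem_filter, mem_TF]
  set φ : Equiv.Perm ℤ → Equiv.Perm ℤ := fun x =>
    if e n i - e n (y i) ∈ Mv n x then x else x * rf i (x⁻¹ (y i)) with hφ
  have hmaps : ∀ x ∈ X, φ x ∈ X.filter (fun u => e n i - e n (y i) ∈ Mv n u) := by
    intro x hx
    rw [mX] at hx
    have hle := le_of_Mv hg hgt hx.1 hy hx.2
    rw [Finset.mem_filter, mX]
    by_cases h : e n i - e n (y i) ∈ Mv n x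
    · simp only [hφ, if_pos h]; exact ⟨hx, h⟩
    · simp only [hφ, if_neg h]
      obtain ⟨j1, j2, j3, j4, j5, j6, j7⟩ := join_up hx.1.1 hy.1 hle hi h
      refine ⟨⟨⟨j3, le_tr j4 hy.2⟩, le_Mv j4⟩, ?_⟩
      rw [j7]
      exact Submodule.mem_sup_right (Submodule.mem_span_singleton_self _)
  rw [← Finset.sum_fiberwise_of_maps_to hmaps]
  apply Finset.sum_eq_zero
  intro u hu
  rw [Finset.mem_filter, mX] at hu
  obtain ⟨⟨huT, huy⟩, hα⟩ := hu
  have hle := le_of_Mv hg hgt huT hy huy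
  have hui := fix_val huT.1 hy.1 hle hi hα
  have hi0 := S_ne hi
  have hfib : X.filter (fun x => φ x = u) = insert u ((K n u i).image (fun k => u * rf i k)) := by
    ext x
    rw [Finset.mem_filter, mX, Finset.mem_insert, Finset.mem_image]
    constructor
    · rintro ⟨⟨hxT, hxy⟩, hxu⟩
      by_cases h : e n i - e n (y i) ∈ Mv n x
      · simp only [hφ, if_pos h] at hxu; exact Or.inl hxu
      · simp only [hφ, if_neg h] at hxu
        right
        obtain ⟨j1, j2, j3, j4, j5, j6, j7⟩ := join_up hxT.1 hy.1 (le_of_Mv hg hgt hxT hy hxy) hi h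
        refine ⟨x⁻¹ (y i), ?_, ?_⟩
        · rw [mem_K]
          refine ⟨j1, j2, ?_⟩
          have h1 : Mv n x ≤ Mv n u := by rw [← hxu]; exact le_Mv j5
          have h2 := h1 (mem_Mv x (x⁻¹ (y i)))
          rw [ai] at h2
          have := Submodule.add_mem _ hα h2
          rwa [sub_add_sub_cancel] at this
        · rw [← hxu, mul_assoc, rf_rf hi0 (S_ne j1) j2, mul_one]
    · rintro (rfl | ⟨k, hk, rfl⟩)
      · exact ⟨⟨huT, huy⟩, by simp only [hφ, if_pos hα]⟩
      · rw [mem_K] at hk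
        obtain ⟨hk1, hk2, hk3⟩ := hk
        have hk0 := S_ne hk1
        have hxu := rf_right_le huT.1 hi hk1 hk2 hk3
        have hxB : inB n (u * rf i k) := inB_mul huT.1 (rf_inB hi hk1 hk2)
        refine ⟨⟨⟨hxB, le_tr hxu huT.2⟩, (le_Mv hxu).trans huy⟩, ?_⟩
        have hxk : (u * rf i k) k = y i := by
          rw [Equiv.Perm.mul_apply, rf_right hi0 hk0, hui]
        have hback : u * rf i k * rf i k = u := by rw [mul_assoc, rf_rf hi0 hk0 hk2, mul_one]
        have hn : e n i - e n (y i) ∉ Mv n (u * rf i k) := by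
          intro h
          have h2 := mem_Mv (n := n) (u * rf i k) k
          rw [hxk] at h2
          have h3 := Submodule.add_mem _ h h2
          rw [sub_add_sub_cancel] at h3
          have c1 := carter_right hxB hi hk1 hk2 h3
          rw [hback] at c1
          have c2 := carter_right huT.1 hi hk1 hk2 hk3
          omega
        have hinv : (u * rf i k)⁻¹ (y i) = k := by
          rw [← hxk, ia]
        simp only [hφ, if_neg hn]
        rw [hinv, hback]
  rw [hfib, Finset.sum_insert, Finset.sum_image]
  · exact hloc u huT hle hui
  · intro a ha b hb hab
    have ha1 := mem_K.1 (Finset.mem_coe.1 ha)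
    have hb1 := mem_K.1 (Finset.mem_coe.1 hb)
    have h1 : rf i a = rf i b := mul_left_cancel hab
    have h2 := congrArg (fun f : Equiv.Perm ℤ => f i) h1
    simp only [rf_left hi0 (S_ne ha1.1), rf_left hi0 (S_ne hb1.1)] at h2
    exact h2
  · intro h
    rw [Finset.mem_image] at h
    obtain ⟨k, hk, hku⟩ := h
    rw [mem_K] at hk
    have c2 := carter_right huT.1 hi hk.1 hk.2.1 hk.2.2
    rw [hku] at c2
    omega

lemma F_sum {p : ℕ} (hp : 1 ≤ p) {y : Equiv.Perm ℤ} (hy : y ∈ T (p+1) (gammaPQ p 1)) (hy1 : y ≠ 1) :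
    ∑ x ∈ (TF (p+1) (gammaPQ p 1)).filter (fun x => Mv (p+1) x ≤ Mv (p+1) y), F (p+1) x = 0 := by
  by_cases hex : ∃ i, Out (p+1) i ∧ y i ≠ i
  · obtain ⟨i, hi, hyi⟩ := hex
    apply regroup (gam_inB hp) (gam_Mv hp) hy hi.1
    intro u hu _ hui
    exact local_id (T_nice hp hu) hi (by rw [hui]; exact hyi)
  · push Not at hex
    have hfix : ∀ i, Out (p+1) i → y i = i := hex
    have hnS : (((p+1:ℕ)):ℤ) ∈ signedSet (p+1) := n_S (by omega)
    have hyn : y ((p+1:ℕ):ℤ) = -((p+1:ℕ):ℤ) := by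
      have hyS := (inB_mem hy.1).2 hnS
      by_contra hne
      apply hy1
      have hyn' : y ((p+1:ℕ):ℤ) = ((p+1:ℕ):ℤ) := by
        by_contra hne2
        have := hfix _ ⟨hyS, hne2, hne⟩
        exact hne2 (y.injective this)
      ext b
      rw [Equiv.Perm.one_apply]
      by_cases hb : b ∈ signedSet (p+1)
      · by_cases hb1 : b = ((p+1:ℕ):ℤ)
        · rw [hb1, hyn']
        by_cases hb2 : b = -((p+1:ℕ):ℤ)
        · rw [hb2, hy.1.1, hyn']
        exact hfix b ⟨hb, hb1, hb2⟩
      · exact hy.1.2 b hb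
    apply regroup (gam_inB hp) (gam_Mv hp) hy hnS
    intro u hu hle hun
    have hyu : Mv (p+1) y ≤ Mv (p+1) u := by
      refine Mv_le ?_ hy.1
      intro b hb
      by_cases hb1 : b = ((p+1:ℕ):ℤ)
      · rw [hb1, ← hun]; exact mem_Mv _ _
      by_cases hb2 : b = -((p+1:ℕ):ℤ)
      · have := mem_Mv (n := p+1) u (-((p+1:ℕ):ℤ))
        rw [hu.1.1, hun, ← hy.1.1] at this
        rw [hb2]; exact this
      · rw [hfix b ⟨hb, hb1, hb2⟩, sub_self]; exact Submodule.zero_mem _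
    have huy : u = y := eq_of_Mv (gam_inB hp) (gam_Mv hp) hu hy (le_antisymm (le_Mv hle) hyu)
    rw [huy]
    exact local_n (by omega) hy.1 hyn hfix

lemma F_gam {p : ℕ} (hp : 1 ≤ p) : F (p+1) (gammaPQ p 1) = gg p := by
  have hz : ∀ b, b ∈ signedSet (p+1) → Zr (gammaPQ p 1) b := fun b hb => gam_Zr hp hb
  have hZo : Zo (p+1) (gammaPQ p 1) = Finset.Icc 1 (p:ℤ) := by
    ext b
    rw [Zo, Finset.mem_filter, Finset.mem_Icc, Finset.mem_Icc]
    constructor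
    · rintro ⟨h1, h2, _⟩
      push_cast at *
      omega
    · intro h
      have : b ∈ signedSet (p+1) := by rw [mem_S]; push_cast; omega
      refine ⟨by push_cast; omega, by push_cast; omega, hz b this⟩
  rw [F, hZo, psi, if_pos (hz _ (n_S (by omega))), Finset.prod_eq_one]
  · simp
  · intro b hb
    rw [Finset.mem_Icc] at hb
    rw [term, if_pos (hz b (Icc_S hb))]

lemma uniq {g : Equiv.Perm ℤ} (hg : inB n g) (hgt : Mv n g = ⊤) (G H : Equiv.Perm ℤ → ℚ)
    (h1 : G 1 = H 1)
    (hG : ∀ y ∈ T n g, y ≠ 1 → ∑ x ∈ (TF n g).filter (fun x => Mv n x ≤ Mv n y), G x = 0)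
    (hH : ∀ y ∈ T n g, y ≠ 1 → ∑ x ∈ (TF n g).filter (fun x => Mv n x ≤ Mv n y), H x = 0) :
    ∀ r, ∀ y ∈ T n g, rk n y = r → G y = H y := by
  intro r
  induction r using Nat.strong_induction_on with
  | _ r ih =>
    intro y hy hr
    by_cases hy1 : y = 1
    · rw [hy1, h1]
    have a := hG y hy hy1
    have b := hH y hy hy1
    have hmem : y ∈ (TF n g).filter (fun x => Mv n x ≤ Mv n y) := by
      rw [Finset.mem_filter, mem_TF]; exact ⟨hy, le_rfl⟩
    rw [← Finset.add_sum_erase _ _ hmem] at a b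
    have c : ∑ x ∈ ((TF n g).filter (fun x => Mv n x ≤ Mv n y)).erase y, G x =
        ∑ x ∈ ((TF n g).filter (fun x => Mv n x ≤ Mv n y)).erase y, H x := by
      apply Finset.sum_congr rfl
      intro x hx
      rw [Finset.mem_erase, Finset.mem_filter, mem_TF] at hx
      apply ih (rk n x) _ x hx.2.1 rfl
      rw [← hr]
      apply Submodule.finrank_lt_finrank_of_lt
      apply lt_of_le_of_ne hx.2.2
      intro h
      exact hx.1 (eq_of_Mv hg hgt hx.2.1 hy h)
    linarith

end NB

namespace NB
open Classical

lemma snc_T {p : ℕ} (hp : 1 ≤ p) (w : Equiv.Perm ℤ) : w ∈ SncB p 1 ↔ w ∈ T (p+1) (gammaPQ p 1) := by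
  constructor
  · rintro ⟨h1, h2⟩
    exact ⟨h1, (leB_iff h1 (gam_inB hp)).1 h2⟩
  · rintro ⟨h1, h2⟩
    exact ⟨h1, (leB_iff h1 (gam_inB hp)).2 h2⟩

lemma main {p : ℕ} (hp : 1 ≤ p) (μ : Set (Set ℤ) → Set (Set ℤ) → ℤ)
    (hrefl : ∀ x ∈ NCB p 1, μ x x = 1)
    (hrec : ∀ x ∈ NCB p 1, ∀ y ∈ NCB p 1, refines x y → x ≠ y →
      (∑ᶠ z ∈ {z | z ∈ NCB p 1 ∧ refines x z ∧ refines z y}, μ x z) = 0) :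
    (μ (botNCB (p + 1)) (topNCB (p + 1)) : ℚ) = gg p := by
  have hgB := gam_inB hp
  have hgt := gam_Mv hp
  have h1T : (1 : Equiv.Perm ℤ) ∈ T (p+1) (gammaPQ p 1) := ⟨inB_one, one_le _⟩
  have hgT : gammaPQ p 1 ∈ T (p+1) (gammaPQ p 1) := ⟨hgB, le_rfl' _⟩
  have hN : ∀ w ∈ T (p+1) (gammaPQ p 1), omegaTilde (p+1) w ∈ NCB p 1 :=
    fun w hw => ⟨w, (snc_T hp w).2 hw, rfl⟩
  have hinj : ∀ x ∈ T (p+1) (gammaPQ p 1), ∀ y ∈ T (p+1) (gammaPQ p 1),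
      omegaTilde (p+1) x = omegaTilde (p+1) y → x = y := fun x hx y hy h =>
    eq_of_Mv hgB hgt hx hy (omega_Mv hx.1 hy.1 h)
  have hbot : botNCB (p+1) = omegaTilde (p+1) 1 := omega_one.symm
  have htop : topNCB (p+1) = omegaTilde (p+1) (gammaPQ p 1) := (omega_top hgB hgt (by omega)).symm
  have hb : ∀ w ∈ T (p+1) (gammaPQ p 1), refines (omegaTilde (p+1) 1) (omegaTilde (p+1) w) := by
    intro w hw
    rw [ref_iff inB_one hw.1, Mv_one]
    exact bot_le
  have key := uniq hgB hgt (fun w => (μ (omegaTilde (p+1) 1) (omegaTilde (p+1) w) : ℚ)) (F (p+1))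
    (by rw [hrefl _ (hN 1 h1T), F_one (by omega)]; simp) ?_ (fun y hy hy1 => F_sum hp hy hy1)
    _ (gammaPQ p 1) hgT rfl
  · rw [hbot, htop, key, F_gam hp]
  · intro y hy hy1
    have h := hrec _ (hN 1 h1T) _ (hN y hy) (hb y hy) (fun h => hy1 (hinj _ h1T _ hy h).symm)
    have hset : {z | z ∈ NCB p 1 ∧ refines (omegaTilde (p+1) 1) z ∧ refines z (omegaTilde (p+1) y)} =
        omegaTilde (p+1) '' (((TF (p+1) (gammaPQ p 1)).filter (fun x => Mv (p+1) x ≤ Mv (p+1) y) :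
          Finset (Equiv.Perm ℤ)) : Set (Equiv.Perm ℤ)) := by
      ext z
      rw [Set.mem_image]
      constructor
      · rintro ⟨⟨w, hw, rfl⟩, _, h3⟩
        rw [snc_T hp] at hw
        refine ⟨w, ?_, rfl⟩
        rw [Finset.mem_coe, Finset.mem_filter, mem_TF]
        exact ⟨hw, (ref_iff hw.1 hy.1).1 h3⟩
      · rintro ⟨w, hw, rfl⟩
        rw [Finset.mem_coe, Finset.mem_filter, mem_TF] at hw
        exact ⟨hN w hw.1, hb w hw.1, (ref_iff hw.1.1 hy.1).2 hw.2⟩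
    rw [hset, finsum_mem_image, finsum_mem_coe_finset] at h
    · exact_mod_cast h
    · intro a ha b hb' hab
      rw [Finset.mem_coe, Finset.mem_filter, mem_TF] at ha hb'
      exact hinj a ha.1 b hb'.1 hab

end NB

/-- For every integer `n ≥ 2`, the Möbius function of the poset `NC^B(n-1,1)`
satisfies `μ(0̂, 1̂) = (-1)^n · C(2n-1, n) · (5n-4)/(4n-2)`. -/
theorem ncb_nm1_1_mobius (n : ℕ) (hn : 2 ≤ n)
    (μ : Set (Set ℤ) → Set (Set ℤ) → ℤ)
    (hrefl : ∀ x ∈ NCB (n - 1) 1, μ x x = 1)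
    (hrec : ∀ x ∈ NCB (n - 1) 1, ∀ y ∈ NCB (n - 1) 1, refines x y → x ≠ y →
      (∑ᶠ z ∈ {z | z ∈ NCB (n - 1) 1 ∧ refines x z ∧ refines z y}, μ x z) = 0) :
    (μ (botNCB (n - 1 + 1)) (topNCB (n - 1 + 1)) : ℚ) =
      (-1 : ℚ) ^ n * (Nat.choose (2 * n - 1) n : ℚ) *
        ((5 * (n : ℚ) - 4) / (4 * (n : ℚ) - 2)) := by
  obtain ⟨p, rfl⟩ : ∃ p, n = p + 1 := ⟨n - 1, by omega⟩
  rw [Nat.add_sub_cancel] at hrefl hrec ⊢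
  rw [NB.main (by omega) μ hrefl hrec, NB.gg_final p (by omega)]
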